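/- Let r ≥ 3 be an integer and let H be a finite graph with chromatic number exactly r whose chromatic threshold δ_χ(H) equals (2r-5)/(2r-3). Let δ be a real number with (2r-5)/(2r-2) ≤ δ ≤ (5r-13)/(5r-8), and set f₁(r,δ) = (-4(r-1)δ² + 4(2r-5)δ + r - 3)/(10r-28). Then for every ε > 0 there exist a constant C and an integer n₀ such that every H-free graph G on n ≥ n₀ vertices with minimum degree at least δn and with more than (f₁(r,δ)+ε)n² edges satisfies χ(G) ≤ C. -/

import Mathlib

open SimpleGraph

/-- `H` is contained in `G` as a (not necessarily induced) subgraph. -/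
def ContainsCopy {α β : Type*} (H : SimpleGraph α) (G : SimpleGraph β) : Prop :=
  ∃ f : α → β, Function.Injective f ∧ ∀ ⦃a b⦄, H.Adj a b → G.Adj (f a) (f b)

/-- The chromatic threshold of `H`: the infimum of all `d > 0` such that there is a constant
`C` for which every `H`-free graph `G` on `n` vertices with minimum degree at least `d·n`
satisfies `χ(G) ≤ C`. -/
noncomputable def chromThreshold {α : Type*} (H : SimpleGraph α) : ℝ :=
  sInf {d : ℝ | 0 < d ∧ ∃ C : ℕ, ∀ (n : ℕ) (G : SimpleGraph (Fin n)),
    ¬ ContainsCopy H G → (∀ v, d * n ≤ ((G.neighborSet v).ncard : ℝ)) →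
    G.chromaticNumber ≤ (C : ℕ∞) }



section CTbasic
open Finset
open scoped BigOperators Classical

/-- Real valued indicator of a proposition. -/
noncomputable def ctInd (p : Prop) : ℝ := if p then 1 else 0

lemma ctInd_true {p : Prop} (h : p) : ctInd p = 1 := if_pos h
lemma ctInd_false {p : Prop} (h : ¬ p) : ctInd p = 0 := if_neg h
lemma ctInd_nonneg (p : Prop) : 0 ≤ ctInd p := by unfold ctInd; split_ifs <;> norm_num
lemma ctInd_le_one (p : Prop) : ctInd p ≤ 1 := by unfold ctInd; split_ifs <;> norm_num
lemma ctInd_mono {p q : Prop} (h : p → q) : ctInd p ≤ ctInd q := by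
  unfold ctInd; by_cases hp : p <;> by_cases hq : q <;> simp [hp, hq]; exact absurd (h hp) hq
lemma ctInd_congr {p q : Prop} (h : p ↔ q) : ctInd p = ctInd q := by rw [propext h]
lemma ctInd_and (p q : Prop) : ctInd (p ∧ q) = ctInd p * ctInd q := by
  unfold ctInd; by_cases hp : p <;> by_cases hq : q <;> simp [hp, hq]
lemma ctInd_or_le (p q : Prop) : ctInd (p ∨ q) ≤ ctInd p + ctInd q := by
  unfold ctInd; by_cases hp : p <;> by_cases hq : q <;> simp [hp, hq]
lemma ctInd_abs (p : Prop) : |ctInd p| ≤ 1 := by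
  rw [abs_of_nonneg (ctInd_nonneg p)]; exact ctInd_le_one p
lemma ctInd_forall {ι : Type*} [Fintype ι] (p : ι → Prop) :
    ∏ i, ctInd (p i) = ctInd (∀ i, p i) := by
  unfold ctInd; rw [Fintype.prod_boole]; congr
lemma ctInd_exists_le {ι : Type*} [Fintype ι] (p : ι → Prop) :
    ctInd (∃ i, p i) ≤ ∑ i, ctInd (p i) := by
  by_cases h : ∃ i, p i
  · rw [ctInd_true h]
    obtain ⟨i, hi⟩ := h
    calc (1:ℝ) = ctInd (p i) := (ctInd_true hi).symm
      _ ≤ _ := Finset.single_le_sum (f := fun i => ctInd (p i))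
        (fun _ _ => ctInd_nonneg _) (Finset.mem_univ i)
  · rw [ctInd_false h]; exact Finset.sum_nonneg fun _ _ => ctInd_nonneg _

lemma ctInd_sum {ι : Type*} (s : Finset ι) (p : ι → Prop) [DecidablePred p] :
    ∑ i ∈ s, ctInd (p i) = ((s.filter p).card : ℝ) := by
  rw [Finset.card_filter, Nat.cast_sum]
  exact Finset.sum_congr rfl fun i _ => by by_cases h : p i <;> simp [ctInd, h]

/-- Density of a predicate on a finite type. -/
noncomputable def ctDens {Ω : Type*} [Fintype Ω] (p : Ω → Prop) : ℝ := 𝔼 x, ctInd (p x)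

lemma ctDens_mono {Ω : Type*} [Fintype Ω] {p q : Ω → Prop} (h : ∀ x, p x → q x) :
    ctDens p ≤ ctDens q := Finset.expect_le_expect fun x _ => ctInd_mono (h x)

lemma ctDens_nonneg {Ω : Type*} [Fintype Ω] (p : Ω → Prop) : 0 ≤ ctDens p :=
  Finset.expect_nonneg fun _ _ => ctInd_nonneg _

lemma ctDens_card {Ω : Type*} [Fintype Ω] (p : Ω → Prop) [DecidablePred p] :
    ctDens p = ((univ.filter p).card : ℝ) / Fintype.card Ω := by
  unfold ctDens; rw [Fintype.expect_eq_sum_div_card, ctInd_sum]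

lemma ct_expect_equiv_prod {A B C : Type*} [Fintype A] [Fintype B] [Fintype C]
    (e : A × B ≃ C) (g : C → ℝ) : 𝔼 x, g x = 𝔼 a, 𝔼 b, g (e (a, b)) := by
  rw [← Fintype.expect_equiv e (fun p => g (e p)) g (fun _ => rfl)]
  exact Finset.expect_product (univ : Finset A) (univ : Finset B) (fun p => g (e p))

lemma ct_marg {ι κ V : Type*} [Fintype ι] [DecidableEq ι] [Fintype κ] [DecidableEq κ] [Fintype V] [Nonempty V]
    (e : κ → ι) (he : Function.Injective e) (g : (κ → V) → ℝ) :
    𝔼 s : ι → V, g (s ∘ e) = 𝔼 x, g x := by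
  let p : ι → Prop := fun i => i ∈ Set.range e
  let E1 := Equiv.piEquivPiSubtypeProd p (fun _ => V)
  let E2 : ({i // p i} → V) ≃ (κ → V) := (Equiv.ofInjective e he).symm.arrowCongr (Equiv.refl V)
  let E : (κ → V) × ({i // ¬ p i} → V) ≃ (ι → V) :=
    ((E1.trans (Equiv.prodCongr E2 (Equiv.refl _)))).symm
  rw [ct_expect_equiv_prod E]
  have key : ∀ a b, g (E (a, b) ∘ e) = g a := by
    intro a b
    congr 1
    have h1 : E.symm (E (a, b)) = (a, b) := E.symm_apply_apply _
    have h2 : (E.symm (E (a, b))).1 = a := by rw [h1]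
    nth_rewrite 2 [← h2]
    rfl
  simp only [key]
  refine Finset.expect_congr rfl fun a _ => ?_
  exact Fintype.expect_const _

lemma ct_cons {n : ℕ} {V : Type*} [Fintype V] (g : (Fin (n+1) → V) → ℝ) :
    𝔼 x, g x = 𝔼 a : V, 𝔼 y : Fin n → V, g (Fin.cons a y) :=
  ct_expect_equiv_prod (Fin.consEquiv (fun _ => V)) g

lemma ct_insertNth {n : ℕ} {V : Type*} [Fintype V] (j : Fin (n+1)) (g : (Fin (n+1) → V) → ℝ) :
    𝔼 x, g x = 𝔼 a : V, 𝔼 y : Fin n → V, g (Fin.insertNth j a y) :=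
  ct_expect_equiv_prod (Fin.insertNthEquiv (fun _ => V) j) g

lemma ct_expect_prod {ι V : Type*} [Fintype ι] [DecidableEq ι] [Fintype V] (h : ι → V → ℝ) :
    𝔼 x : ι → V, ∏ a, h a (x a) = ∏ a, 𝔼 v, h a v := by
  simp only [Fintype.expect_eq_sum_div_card]
  rw [Finset.prod_div_distrib, Fintype.prod_sum]
  simp

lemma ct_jensen {Ω : Type*} [Fintype Ω] [Nonempty Ω] (f : Ω → ℝ) (hf : ∀ x, 0 ≤ f x) (k : ℕ) :
    (𝔼 x, f x) ^ k ≤ 𝔼 x, f x ^ k := by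
  simp only [Fintype.expect_eq_sum_div_card]
  have hc : (0:ℝ) < Fintype.card Ω := by exact_mod_cast Fintype.card_pos
  have := Real.pow_arith_mean_le_arith_mean_pow (univ : Finset Ω)
    (fun _ => (1:ℝ) / Fintype.card Ω) f (fun _ _ => by positivity) (by simp)
    (fun x _ => hf x) k
  simp only [← Finset.mul_sum] at this
  have e : ∀ z : ℝ, z / Fintype.card Ω = 1 / Fintype.card Ω * z := fun z => by ring
  rw [e (∑ x, f x), e (∑ x, f x ^ k)]
  exact this

lemma ct_blow {V T : Type*} [Fintype V] [Nonempty V] [Fintype T] [DecidableEq T] (s : ℕ) :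
    ∀ g : (Fin s → V) → ℝ, (∀ x, 0 ≤ g x) →
    (𝔼 x, g x) ^ (Fintype.card T ^ s) ≤
      𝔼 X : Fin s → (T → V), ∏ τ : Fin s → T, g (fun i => X i (τ i)) := by
  induction s with
  | zero =>
    intro g hg
    simp only [pow_zero, pow_one]
    have h1 : ∀ x : Fin 0 → V, g x = g Fin.elim0 := fun x => by congr 1; exact Subsingleton.elim _ _
    have h2 : ∀ X : Fin 0 → (T → V), ∏ τ : Fin 0 → T, g (fun i => X i (τ i)) = g Fin.elim0 := by
      intro X
      simp [h1]
    simp only [h2]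
    simp only [h1]
    rw [Fintype.expect_const, Fintype.expect_const]
  | succ s ih =>
    intro g hg
    rw [ct_cons (V := T → V)]
    have hp : ∀ (a : T → V) (y : Fin s → T → V),
        ∏ τ : Fin (s+1) → T, g (fun i => (Fin.cons a y : Fin (s+1) → T → V) i (τ i))
        = ∏ b : T, ∏ τ : Fin s → T, g (Fin.cons (a b) (fun i => y i (τ i))) := by
      intro a y
      rw [← Equiv.prod_comp (Fin.consEquiv (fun _ => T)), Fintype.prod_prod_type]
      refine Finset.prod_congr rfl fun b _ => Finset.prod_congr rfl fun τ _ => ?_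
      congr 1
      funext i
      refine Fin.cases ?_ (fun i => ?_) i <;> simp [Fin.consEquiv]
    simp only [hp]
    rw [Finset.expect_comm]
    have h3 : ∀ y : Fin s → T → V,
        𝔼 a : T → V, ∏ b : T, ∏ τ : Fin s → T, g (Fin.cons (a b) (fun i => y i (τ i)))
        = (𝔼 v : V, ∏ τ : Fin s → T, g (Fin.cons v (fun i => y i (τ i)))) ^ Fintype.card T := by
      intro y
      rw [ct_expect_prod (fun (_ : T) (v : V) => ∏ τ : Fin s → T, g (Fin.cons v (fun i => y i (τ i))))]
      simp
    simp only [h3]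
    refine le_trans ?_ (ct_jensen _ (fun y => Finset.expect_nonneg fun v _ =>
      Finset.prod_nonneg fun τ _ => hg _) _)
    rw [pow_succ, pow_mul]
    refine pow_le_pow_left₀ ?_ ?_ _
    · exact pow_nonneg (Finset.expect_nonneg fun v _ => hg _) _
    rw [Finset.expect_comm, ct_cons]
    refine le_trans (ct_jensen _ (fun y => Finset.expect_nonneg fun v _ => hg _) _) ?_
    refine Finset.expect_le_expect fun v _ => ?_
    exact ih (fun x => g (Fin.cons v x)) (fun x => hg _)

end CTbasic

section CTgraph
open Finset
open scoped BigOperators Classical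

/-- Degree of `v` into the finset `T`. -/
noncomputable def ctDeg {V : Type*} (G : SimpleGraph V) (T : Finset V) (v : V) : ℕ :=
  (T.filter (fun w => G.Adj v w)).card

lemma ctDeg_insert {V : Type*} (G : SimpleGraph V) (T : Finset V) (v w : V) (hv : v ∉ T) :
    ctDeg G (insert v T) w = ctDeg G T w + (if G.Adj w v then 1 else 0) := by
  unfold ctDeg
  rw [Finset.filter_insert]
  split_ifs with h
  · rw [Finset.card_insert_of_notMem (by simp [hv])]
  · rfl

lemma ctDeg_sum_insert {V : Type*} (G : SimpleGraph V) (T : Finset V) (v : V) (hv : v ∉ T) :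
    ∑ w ∈ insert v T, ctDeg G (insert v T) w = ∑ w ∈ T, ctDeg G T w + 2 * ctDeg G T v := by
  rw [Finset.sum_insert hv]
  simp only [ctDeg_insert G T v _ hv, Finset.sum_add_distrib]
  have : ∑ w ∈ T, (if G.Adj w v then 1 else 0) = ctDeg G T v := by
    unfold ctDeg
    rw [Finset.card_filter]
    exact Finset.sum_congr rfl fun w _ => by simp [G.adj_comm]
  rw [this]; simp; ring

lemma ct_dense_sub {V : Type*} (G : SimpleGraph V) (k : ℕ) (S : Finset V)
    (h : 2 * k * S.card < ∑ v ∈ S, ctDeg G S v) :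
    ∃ T ⊆ S, T.Nonempty ∧ ∀ v ∈ T, k ≤ ctDeg G T v := by
  obtain ⟨T, hT, hmax⟩ := Finset.exists_max_image S.powerset
    (fun T => ((∑ v ∈ T, ctDeg G T v : ℕ) : ℤ) - 2 * k * T.card) ⟨S, by simp⟩
  have h1 := hmax S (by simp)
  refine ⟨T, Finset.mem_powerset.1 hT, ?_, ?_⟩
  · by_contra hne
    rw [Finset.not_nonempty_iff_eq_empty] at hne
    subst hne
    simp only [Finset.sum_empty, Finset.card_empty] at h1
    zify at h
    push_cast at h1
    linarith
  · intro v hv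
    have h2 := hmax (T.erase v) (by
      rw [Finset.mem_powerset]
      exact (Finset.erase_subset _ _).trans (Finset.mem_powerset.1 hT))
    have h3 := ctDeg_sum_insert G (T.erase v) v (by simp)
    have h4 : ctDeg G T v = ctDeg G (T.erase v) v := by
      have := ctDeg_insert G (T.erase v) v v (by simp)
      rw [Finset.insert_erase hv] at this
      simpa using this
    rw [Finset.insert_erase hv] at h3
    have h5 : (T.erase v).card + 1 = T.card := Finset.card_erase_add_one hv
    simp only [h3, ← h5] at h2
    push_cast at h2
    have : (k:ℤ) ≤ ctDeg G (T.erase v) v := by linarith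
    rw [h4]; exact_mod_cast this

lemma ct_degen_color {V : Type*} (G : SimpleGraph V) (D : ℕ) (S : Finset V) :
    (∀ T ⊆ S, T.Nonempty → ∃ v ∈ T, ctDeg G T v ≤ D) →
    ∃ c : V → Fin (D+1), ∀ u ∈ S, ∀ v ∈ S, G.Adj u v → c u ≠ c v := by
  induction S using Finset.strongInduction with
  | H S ih =>
    intro h
    rcases S.eq_empty_or_nonempty with rfl | hne
    · exact ⟨fun _ => 0, by simp⟩
    obtain ⟨v, hv, hd⟩ := h S subset_rfl hne
    obtain ⟨c, hc⟩ := ih (S.erase v) (Finset.erase_ssubset hv)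
      (fun T hT => h T (hT.trans (Finset.erase_subset _ _)))
    have : ∃ x : Fin (D+1), x ∉ (S.filter (fun w => G.Adj v w)).image c := by
      by_contra hcon
      push Not at hcon
      have h1 : (univ : Finset (Fin (D+1))).card ≤ ((S.filter (fun w => G.Adj v w)).image c).card :=
        Finset.card_le_card fun x _ => hcon x
      have h2 := h1.trans Finset.card_image_le
      simp only [Finset.card_univ, Fintype.card_fin] at h2
      unfold ctDeg at hd
      omega
    obtain ⟨x, hx⟩ := this
    simp only [Finset.mem_image, Finset.mem_filter, not_exists, not_and, and_imp] at hx
    refine ⟨Function.update c v x, ?_⟩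
    intro a ha b hb hab
    by_cases hav : a = v
    · subst hav
      have hba : b ≠ a := hab.ne'
      simp only [Function.update_self, Function.update_of_ne hba]
      exact fun he => hx b hb hab he.symm
    · by_cases hbv : b = v
      · subst hbv
        simp only [Function.update_self, Function.update_of_ne hav]
        exact fun he => hx a ha hab.symm he
      · simp only [Function.update_of_ne hav, Function.update_of_ne hbv]
        exact hc a (by simp [hav, ha]) b (by simp [hbv, hb]) hab

lemma ct_forest_embed {α V : Type*} (F : SimpleGraph α) (G : SimpleGraph V) (k : ℕ)
    (T : Finset V) (hT : T.Nonempty) (hk : ∀ v ∈ T, k ≤ ctDeg G T v) (A : Finset α) :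
    (∀ B ⊆ A, B.Nonempty → ∃ a ∈ B, ctDeg F B a ≤ 1) → A.card ≤ k →
    ∃ f : α → V, Set.InjOn f A ∧ (∀ a ∈ A, f a ∈ T) ∧
      ∀ a ∈ A, ∀ b ∈ A, F.Adj a b → G.Adj (f a) (f b) := by
  induction A using Finset.strongInduction with
  | H A ih =>
    intro h hcard
    obtain ⟨t0, ht0⟩ := hT
    rcases A.eq_empty_or_nonempty with rfl | hne
    · exact ⟨fun _ => t0, by simp⟩
    obtain ⟨v, hv, hd⟩ := h A subset_rfl hne
    have hcc : (A.erase v).card + 1 = A.card := Finset.card_erase_add_one hv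
    obtain ⟨f, hinj, hmem, hadj⟩ := ih (A.erase v) (Finset.erase_ssubset hv)
      (fun T hT => h T (hT.trans (Finset.erase_subset _ _))) (by omega)
    -- the place of `v`
    have key : ∃ y ∈ T, y ∉ (A.erase v).image f ∧ ∀ b ∈ A, F.Adj v b → G.Adj y (f b) := by
      by_cases hnb : ∃ b ∈ A, F.Adj v b
      · obtain ⟨b, hb, hvb⟩ := hnb
        have hbe : b ∈ A.erase v := by simp [hb, hvb.ne']
        have huniq : ∀ b' ∈ A, F.Adj v b' → b' = b := by
          intro b' hb' hvb'
          exact Finset.card_le_one.1 hd b' (by simp [hb', hvb']) b (by simp [hb, hvb])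
        have h1 := hk (f b) (hmem b hbe)
        have h2 : (((A.erase v).image f).erase (f b)).card < ctDeg G T (f b) := by
          have : ((A.erase v).image f).card ≤ (A.erase v).card := Finset.card_image_le
          have h3 : (((A.erase v).image f).erase (f b)).card + 1 = ((A.erase v).image f).card :=
            Finset.card_erase_add_one (Finset.mem_image_of_mem f hbe)
          omega
        obtain ⟨y, hy, hy'⟩ := Finset.exists_mem_notMem_of_card_lt_card h2
        simp only [Finset.mem_filter] at hy
        refine ⟨y, hy.1, ?_, ?_⟩
        · intro hyi
          exact hy' (Finset.mem_erase.2 ⟨hy.2.ne', hyi⟩)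
        · intro b' hb' hvb'
          rw [huniq b' hb' hvb']; exact hy.2.symm
      · push Not at hnb
        have h1 := hk t0 ht0
        have h2 : ((A.erase v).image f).card < T.card := by
          have : ((A.erase v).image f).card ≤ (A.erase v).card := Finset.card_image_le
          have h3 : ctDeg G T t0 ≤ T.card := Finset.card_filter_le _ _
          omega
        obtain ⟨y, hy, hy'⟩ := Finset.exists_mem_notMem_of_card_lt_card h2
        exact ⟨y, hy, hy', fun b hb hvb => absurd hvb (hnb b hb)⟩
    obtain ⟨y, hyT, hyn, hya⟩ := key
    have hyn' : ∀ a ∈ A, a ≠ v → f a ≠ y := fun a ha hav he =>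
      hyn (Finset.mem_image.2 ⟨a, by simp [hav, ha], he⟩)
    refine ⟨Function.update f v y, ?_, ?_, ?_⟩
    · intro a ha b hb hab
      by_cases hav : a = v <;> by_cases hbv : b = v
      · rw [hav, hbv]
      · subst hav
        simp only [Function.update_self, Function.update_of_ne hbv] at hab
        exact absurd hab.symm (hyn' b hb hbv)
      · subst hbv
        simp only [Function.update_self, Function.update_of_ne hav] at hab
        exact absurd hab (hyn' a ha hav)
      · simp only [Function.update_of_ne hav, Function.update_of_ne hbv] at hab
        exact hinj (by simpa [hav] using ha) (by simpa [hbv] using hb) hab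
    · intro a ha
      by_cases hav : a = v
      · subst hav; simpa using hyT
      · rw [Function.update_of_ne hav]; exact hmem a (by simp [hav, ha])
    · intro a ha b hb hab
      by_cases hav : a = v
      · subst hav
        rw [Function.update_self, Function.update_of_ne hab.ne']
        exact hya b hb hab
      · by_cases hbv : b = v
        · subst hbv
          rw [Function.update_self, Function.update_of_ne hav]
          exact (hya a ha hab.symm).symm
        · rw [Function.update_of_ne hav, Function.update_of_ne hbv]
          exact hadj a (by simp [hav, ha]) b (by simp [hbv, hb]) hab

/-- `x` is a tuple of pairwise adjacent vertices. -/
def ctClq {V : Type*} (G : SimpleGraph V) {s : ℕ} (x : Fin s → V) : Prop :=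
  ∀ i j, i ≠ j → G.Adj (x i) (x j)

lemma ct_embed {α V : Type*} (H : SimpleGraph α) (G : SimpleGraph V) (S : ℕ)
    (c : α → Fin (S+1)) (hc : ∀ a b, H.Adj a b → c a = c b → c a = 0)
    (X : Fin S → α → V) (hX : ∀ i, Function.Injective (X i))
    (hclq : ∀ τ : Fin S → α, ctClq G (fun i => X i (τ i)))
    (f : α → V) (hf : ∀ a b, c a = 0 → c b = 0 → f a = f b → a = b)
    (hfa : ∀ a b, c a = 0 → c b = 0 → H.Adj a b → G.Adj (f a) (f b))
    (hfX : ∀ a, c a = 0 → ∀ i b, G.Adj (f a) (X i b)) : ContainsCopy H G := by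
  have hXX : ∀ i j a b, i ≠ j → G.Adj (X i a) (X j b) := by
    intro i j a b hij
    have := hclq (fun l => if l = i then a else b) i j hij
    simpa [hij.symm] using this
  let F : Fin (S+1) → α → V := fun i a => Fin.cases (f a) (fun j => X j a) i
  have hF : ∀ i j a b, c a = i → c b = j → i ≠ j → G.Adj (F i a) (F j b) := by
    intro i j a b ha hb hij
    induction i using Fin.cases with
    | zero =>
      induction j using Fin.cases with
      | zero => exact absurd rfl hij
      | succ j => exact hfX a ha j b
    | succ i =>
      induction j using Fin.cases with
      | zero => exact (hfX b hb i a).symm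
      | succ j => exact hXX i j a b (fun h => hij (by rw [h]))
  refine ⟨fun a => F (c a) a, ?_, ?_⟩
  · intro a b hab
    by_cases hcab : c a = c b
    · simp only [hcab] at hab
      generalize hcb : c b = j at hab hcab
      induction j using Fin.cases with
      | zero => exact hf a b hcab hcb hab
      | succ j => exact hX j hab
    · exact absurd hab (hF _ _ a b rfl rfl hcab).ne
  · intro a b hab
    by_cases hcab : c a = c b
    · have h0 := hc a b hab hcab
      have h0' : c b = 0 := by rw [← hcab, h0]
      simp only [h0, h0']
      exact hfa a b h0 h0' hab
    · exact hF _ _ a b rfl rfl hcab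

lemma ct_coll {V : Type*} [Fintype V] [Nonempty V] {α : Type*} [Fintype α] (S : ℕ) (i : Fin S)
    (a b : α) (hab : a ≠ b) :
    𝔼 X : Fin S → α → V, ctInd (X i a = X i b) = 1 / Fintype.card V := by
  have h1 := ct_marg (V := α → V) (fun _ : Fin 1 => i) (fun x y _ => Subsingleton.elim x y)
    (fun z => ctInd (z 0 a = z 0 b))
  simp only [Function.comp_apply] at h1
  rw [h1, ct_cons]
  simp only [Fin.cons_zero, Fintype.expect_const]
  have h2 := ct_marg (V := V) (![a, b]) (by
    intro x y hxy
    fin_cases x <;> fin_cases y <;> simp_all)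
    (fun z => ctInd (z 0 = z 1))
  simp only [Function.comp_apply, Matrix.cons_val_zero, Matrix.cons_val_one] at h2
  rw [h2, ct_cons, Finset.expect_comm]
  have h3 : ∀ y : Fin 1 → V, 𝔼 v : V, ctInd ((Fin.cons v y : Fin 2 → V) 0 = (Fin.cons v y : Fin 2 → V) 1)
      = 1 / Fintype.card V := by
    intro y
    have : ∀ v, ctInd ((Fin.cons v y : Fin 2 → V) 0 = (Fin.cons v y : Fin 2 → V) 1) = ctInd (v = y 0) := by
      intro v; rfl
    simp only [this]
    rw [Fintype.expect_eq_sum_div_card, Finset.sum_eq_single (y 0)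
      (fun v _ hv => ctInd_false hv) (by simp), ctInd_true rfl]
  simp only [h3, Fintype.expect_const]

lemma ct_blow_exists {V : Type*} [Fintype V] [Nonempty V] {α ι : Type*} [Fintype α] [Nonempty α]
    (G : SimpleGraph V) (S : ℕ) (J : Finset ι) (hJ : J.Nonempty) (N : ι → V → Prop) (p : ℝ)
    (hp : 0 < p)
    (hN : ∀ j ∈ J, p ≤ ctDens (fun x : Fin S → V => ctClq G x ∧ ∀ i, N j (x i)))
    (hn : (S * Fintype.card α ^ 2 : ℝ) ≤ p ^ (Fintype.card α ^ S) / 2 * Fintype.card V) :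
    ∃ X : Fin S → α → V, (∀ i, Function.Injective (X i)) ∧
      (∀ τ : Fin S → α, ctClq G (fun i => X i (τ i))) ∧
      p ^ (Fintype.card α ^ S) / 2 * J.card ≤
        ((J.filter (fun j => ∀ i a, N j (X i a))).card : ℝ) := by
  set q := p ^ (Fintype.card α ^ S) with hq
  have hq0 : 0 < q := by positivity
  have hcV : (0:ℝ) < Fintype.card V := by exact_mod_cast Fintype.card_pos
  let good : (Fin S → α → V) → Prop := fun X => (∀ i, Function.Injective (X i)) ∧
      (∀ τ : Fin S → α, ctClq G (fun i => X i (τ i)))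
  let Q : ι → (Fin S → α → V) → Prop := fun j X => ∀ i a, N j (X i a)
  let inj : (Fin S → α → V) → Prop := fun X => ∀ i, Function.Injective (X i)
  have hbad : 𝔼 X : Fin S → α → V, ctInd (¬ inj X) ≤ q / 2 := by
    have h1 : ∀ X : Fin S → α → V, ctInd (¬ inj X) ≤
        ∑ z : Fin S × α × α, (if z.2.1 ≠ z.2.2 then ctInd (X z.1 z.2.1 = X z.1 z.2.2) else 0) := by
      intro X
      refine le_trans (ctInd_mono (q := ∃ z : Fin S × α × α, z.2.1 ≠ z.2.2 ∧
        X z.1 z.2.1 = X z.1 z.2.2) ?_) (le_trans (ctInd_exists_le _) ?_)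
      · intro h
        simp only [inj, Function.Injective] at h
        push Not at h
        obtain ⟨i, a, b, h1, h2⟩ := h
        exact ⟨(i, a, b), h2, h1⟩
      · refine Finset.sum_le_sum fun z _ => ?_
        rw [ctInd_and]
        split_ifs with hz
        · rw [ctInd_true hz, one_mul]
        · rw [ctInd_false hz, zero_mul]
    refine le_trans (Finset.expect_le_expect fun X _ => h1 X) ?_
    rw [Finset.expect_sum_comm]
    have h2 : ∀ z : Fin S × α × α, 𝔼 X : Fin S → α → V,
        (if z.2.1 ≠ z.2.2 then ctInd (X z.1 z.2.1 = X z.1 z.2.2) else 0) ≤ 1 / Fintype.card V := by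
      intro z
      split_ifs with hz
      · rw [ct_coll S z.1 _ _ hz]
      · rw [Fintype.expect_const]; positivity
    refine le_trans (Finset.sum_le_sum fun z _ => h2 z) ?_
    simp only [Finset.sum_const, Finset.card_univ, Fintype.card_prod, Fintype.card_fin, nsmul_eq_mul]
    rw [mul_one_div, div_le_iff₀ hcV]
    push_cast
    linarith
  have hgood : ∀ j ∈ J, q / 2 ≤ 𝔼 X, ctInd (good X ∧ Q j X) := by
    intro j hj
    have h1 := ct_blow (T := α) S (fun x : Fin S → V => ctInd (ctClq G x ∧ ∀ i, N j (x i)))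
      (fun _ => ctInd_nonneg _)
    simp only [ctInd_forall] at h1
    have h2 : q ≤ (𝔼 x : Fin S → V, ctInd (ctClq G x ∧ ∀ i, N j (x i))) ^ (Fintype.card α ^ S) :=
      pow_le_pow_left₀ hp.le (hN j hj) _
    have h3 : 𝔼 X : Fin S → α → V, ctInd (∀ τ : Fin S → α, ctClq G (fun i => X i (τ i)) ∧
        ∀ i, N j (X i (τ i))) ≤ 𝔼 X : Fin S → α → V, (ctInd (good X ∧ Q j X) + ctInd (¬ inj X)) := by
      refine Finset.expect_le_expect fun X _ => ?_
      refine le_trans (ctInd_mono (q := (good X ∧ Q j X) ∨ ¬ inj X) ?_) (ctInd_or_le _ _)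
      intro h
      by_cases hi : inj X
      · exact Or.inl ⟨⟨hi, fun τ => (h τ).1⟩, fun i a => (h (fun _ => a)).2 i⟩
      · exact Or.inr hi
    rw [Finset.expect_add_distrib] at h3
    linarith
  have hsum : q / 2 * J.card ≤ 𝔼 X, ∑ j ∈ J, ctInd (good X ∧ Q j X) := by
    rw [Finset.expect_sum_comm]
    calc q / 2 * J.card = ∑ j ∈ J, q / 2 := by rw [Finset.sum_const, nsmul_eq_mul, mul_comm]
      _ ≤ _ := Finset.sum_le_sum hgood
  obtain ⟨X, -, hX⟩ := Finset.exists_le_of_le_expect Finset.univ_nonempty hsum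
  have hgX : good X := by
    by_contra hng
    have : ∑ j ∈ J, ctInd (good X ∧ Q j X) = 0 :=
      Finset.sum_eq_zero fun j _ => ctInd_false fun h => hng h.1
    rw [this] at hX
    have : (0:ℝ) < J.card := by exact_mod_cast hJ.card_pos
    have := mul_pos (half_pos hq0) this
    linarith
  refine ⟨X, hgX.1, hgX.2, hX.trans ?_⟩
  rw [← ctInd_sum]
  exact Finset.sum_le_sum fun j _ => ctInd_mono fun h => h.2

end CTgraph

section CTembed
open Finset
open scoped BigOperators Classical

lemma ct_many_nbr {V α : Type*} [Fintype V] [Nonempty V] [Fintype α] [Nonempty α]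
    (H : SimpleGraph α) (G : SimpleGraph V) (S : ℕ) (hfree : ¬ ContainsCopy H G)
    (c : α → Fin (S+1)) (hc : ∀ a b, H.Adj a b → c a ≠ c b) (U : Finset V) (p : ℝ) (hp : 0 < p)
    (hU : ∀ u ∈ U, p ≤ ctDens (fun x : Fin S → V => ctClq G x ∧ ∀ i, G.Adj u (x i)))
    (hn : (S * Fintype.card α ^ 2 : ℝ) ≤ p ^ (Fintype.card α ^ S) / 2 * Fintype.card V) :
    p ^ (Fintype.card α ^ S) / 2 * U.card < Fintype.card α := by
  by_contra hcon
  push Not at hcon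
  have hα : (0:ℝ) < Fintype.card α := by exact_mod_cast Fintype.card_pos
  have hne : U.Nonempty := by
    by_contra h
    rw [Finset.not_nonempty_iff_eq_empty] at h
    subst h
    simp at hcon
  obtain ⟨X, hinj, hclq, hcard⟩ := ct_blow_exists (α := α) G S U hne (fun u v => G.Adj u v) p hp hU hn
  have h1 : Fintype.card α ≤ (U.filter (fun j => ∀ i a, G.Adj j (X i a))).card := by
    exact_mod_cast hcon.trans hcard
  obtain ⟨f⟩ : Nonempty (α ↪ {x // x ∈ U.filter (fun j => ∀ i a, G.Adj j (X i a))}) :=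
    Function.Embedding.nonempty_of_card_le (by rw [Fintype.card_coe]; exact h1)
  refine hfree (ct_embed H G S c (fun a b hab h => absurd h (hc a b hab)) X hinj hclq
    (fun a => (f a).1) (fun a b _ _ h => f.injective (Subtype.ext h)) ?_ ?_)
  · intro a b ha hb hab
    exact absurd (ha.trans hb.symm) (hc a b hab)
  · intro a _ i b
    exact (Finset.mem_filter.1 (f a).2).2 i b

lemma ct_pairs_card {V : Type*} (G : SimpleGraph V) (T : Finset V) :
    ((T ×ˢ T).filter (fun z => G.Adj z.1 z.2)).card = ∑ v ∈ T, ctDeg G T v := by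
  rw [Finset.card_filter, Finset.sum_product]
  refine Finset.sum_congr rfl fun v _ => ?_
  unfold ctDeg
  rw [Finset.card_filter]

lemma ct_forest_copy {V α : Type*} [Fintype V] [Nonempty V] [Fintype α] [Nonempty α]
    (H : SimpleGraph α) (G : SimpleGraph V) (S : ℕ)
    (c : α → Fin (S+1)) (hc : ∀ a b, H.Adj a b → c a = c b → c a = 0)
    (hforest : ∀ B : Finset α, B.Nonempty → (∀ a ∈ B, c a = 0) → ∃ a ∈ B, ctDeg H B a ≤ 1)
    (T : Finset V) (hT : T.Nonempty) (p : ℝ) (hp : 0 < p) (D : ℕ)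
    (hD : (2 * Fintype.card α : ℝ) ≤ p ^ (Fintype.card α ^ S) / 2 * D)
    (hTD : ∀ v ∈ T, D < ctDeg G T v)
    (hE : ∀ u ∈ T, ∀ v ∈ T, G.Adj u v →
      p ≤ ctDens (fun x : Fin S → V => ctClq G x ∧ ∀ i, (G.Adj u (x i) ∧ G.Adj v (x i))))
    (hn : (S * Fintype.card α ^ 2 : ℝ) ≤ p ^ (Fintype.card α ^ S) / 2 * Fintype.card V) :
    ContainsCopy H G := by
  set q := p ^ (Fintype.card α ^ S) with hq
  have hq0 : 0 < q := by positivity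
  set J := (T ×ˢ T).filter (fun z => G.Adj z.1 z.2) with hJ
  have hJc : J.card = ∑ v ∈ T, ctDeg G T v := ct_pairs_card G T
  have hTc : 0 < T.card := hT.card_pos
  have hJD : (D + 1) * T.card ≤ J.card := by
    rw [hJc]
    calc (D+1) * T.card = ∑ v ∈ T, (D+1) := by rw [Finset.sum_const, smul_eq_mul, mul_comm]
      _ ≤ _ := Finset.sum_le_sum fun v hv => hTD v hv
  have hJne : J.Nonempty := by
    rw [← Finset.card_pos]
    have : 0 < (D+1) * T.card := by positivity
    omega
  obtain ⟨X, hinj, hclq, hcard⟩ := ct_blow_exists (α := α) G S J hJne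
    (fun z v => G.Adj z.1 v ∧ G.Adj z.2 v) p hp (by
      intro j hj
      simp only [hJ, Finset.mem_filter, Finset.mem_product] at hj
      exact hE j.1 hj.1.1 j.2 hj.1.2 hj.2) hn
  rw [← hq] at hcard
  set T' := T.filter (fun v => ∀ i a, G.Adj v (X i a)) with hT'
  have hsub : (J.filter (fun j => ∀ i a, G.Adj j.1 (X i a) ∧ G.Adj j.2 (X i a))) ⊆
      (T' ×ˢ T').filter (fun z => G.Adj z.1 z.2) := by
    intro z hz
    simp only [hJ, hT', Finset.mem_filter, Finset.mem_product] at hz ⊢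
    exact ⟨⟨⟨hz.1.1.1, fun i a => (hz.2 i a).1⟩, ⟨hz.1.1.2, fun i a => (hz.2 i a).2⟩⟩, hz.1.2⟩
  have h1 := Finset.card_le_card hsub
  rw [ct_pairs_card] at h1
  have hT'c : T'.card ≤ T.card := Finset.card_filter_le _ _
  have h2 : 2 * Fintype.card α * T'.card < ∑ v ∈ T', ctDeg G T' v := by
    have e1 : ((J.filter (fun j => ∀ i a, G.Adj j.1 (X i a) ∧ G.Adj j.2 (X i a))).card : ℝ) ≤
      ((∑ v ∈ T', ctDeg G T' v : ℕ) : ℝ) := by exact_mod_cast h1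
    have e2 : ((D + 1) * T.card : ℝ) ≤ J.card := by exact_mod_cast hJD
    have e3 : (T'.card : ℝ) ≤ T.card := by exact_mod_cast hT'c
    have e4 : (0:ℝ) < T.card := by exact_mod_cast hTc
    have e5 : q / 2 * ((D + 1) * T.card : ℝ) ≤ q / 2 * J.card :=
      mul_le_mul_of_nonneg_left e2 (by positivity)
    have e6 : (2 * Fintype.card α : ℝ) * T'.card ≤ q / 2 * D * T.card :=
      mul_le_mul hD e3 (by positivity) (by positivity)
    have e7 : 0 < q / 2 * T.card := by positivity
    have : ((2 * Fintype.card α * T'.card : ℕ) : ℝ) < ((∑ v ∈ T', ctDeg G T' v : ℕ) : ℝ) := by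
      have e0 := hcard.trans (le_of_eq_of_le (by congr!) e1)
      push_cast at e0 ⊢
      have e8 : q / 2 * ((D + 1) * T.card : ℝ) = q / 2 * D * T.card + q / 2 * T.card := by ring
      linarith
    exact_mod_cast this
  obtain ⟨T'', hsubT, hne, hdeg⟩ := ct_dense_sub G _ T' h2
  obtain ⟨f, hfi, hfm, hfa⟩ := ct_forest_embed H G _ T'' hne hdeg (univ.filter (fun a => c a = 0))
    (fun B hB hBne => hforest B hBne fun a ha => (Finset.mem_filter.1 (hB ha)).2)
    (Finset.card_le_univ _)
  refine ct_embed H G S c hc X hinj hclq f ?_ ?_ ?_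
  · intro a b ha hb hab
    exact hfi (by simpa using ha) (by simpa using hb) hab
  · intro a b ha hb hab
    exact hfa a (by simpa using ha) b (by simpa using hb) hab
  · intro a ha i b
    exact (Finset.mem_filter.1 (hsubT (hfm a (by simpa using ha)))).2 i b

end CTembed

section CTcover
open Finset
open scoped BigOperators Classical

set_option maxHeartbeats 1000000 in
lemma ct_cover (ε : ℝ) (hε : 0 < ε) : ∃ N : ℕ, ∀ (V X U : Type) [Fintype V] [Fintype X] [Nonempty V]
    [Nonempty X] (φ : X → V → ℝ) (f : U → V → ℝ), (∀ x v, |φ x v| ≤ 1) → (∀ u v, |f u v| ≤ 1) →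
    ∃ col : U → Fin N, ∀ u u', col u = col u' →
      𝔼 x, (𝔼 v, (f u v - f u' v) * φ x v) ^ 2 ≤ ε := by
  -- parameters
  set η := ε / 16 with hη
  have hη0 : 0 < η := by positivity
  set K := ⌊1 / η⌋₊ with hK
  obtain ⟨L, hL⟩ := exists_nat_gt (16 * (K + 1) / ε + 4)
  have hLpos : (0:ℝ) < L := by
    have : 0 < 16 * ((K:ℝ) + 1) / ε := by positivity
    linarith
  refine ⟨∑ k ∈ Finset.range (K+1), (4 * L + 1) ^ k, ?_⟩
  intro V X U _ _ _ _ φ f hφ hf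
  have hV : (0:ℝ) < Fintype.card V := by exact_mod_cast Fintype.card_pos
  have hX : (0:ℝ) < Fintype.card X := by exact_mod_cast Fintype.card_pos
  set n : ℝ := (Fintype.card V : ℝ) with hn
  let E := EuclideanSpace ℝ V
  let Φ : X → E := fun x => WithLp.toLp 2 (φ x)
  let F : U → E := fun u => WithLp.toLp 2 (f u)
  have hnorm : ∀ g : V → ℝ, (∀ v, |g v| ≤ 1) → ‖(WithLp.toLp 2 g : E)‖ ^ 2 ≤ n := by
    intro g hg
    rw [EuclideanSpace.norm_sq_eq]
    calc ∑ i, ‖g i‖ ^ 2 ≤ ∑ i : V, (1:ℝ) := Finset.sum_le_sum fun i _ => by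
          rw [Real.norm_eq_abs]; exact pow_le_one₀ (abs_nonneg _) (hg i)
      _ = n := by simp [hn]
  have hΦ : ∀ x, ‖Φ x‖ ^ 2 ≤ n := fun x => hnorm _ (hφ x)
  have hF : ∀ u, ‖F u‖ ^ 2 ≤ n := fun u => hnorm _ (hf u)
  -- the property of being a family of bad directions
  let Bad : ℕ → Prop := fun k => ∃ e : Fin k → E, Orthonormal ℝ e ∧
    ∀ i, η * n < 𝔼 x, (inner ℝ (e i) (Φ x)) ^ 2
  have hBad0 : Bad 0 := ⟨Fin.elim0, ⟨fun i => i.elim0, fun i => i.elim0⟩, fun i => i.elim0⟩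
  have hbound : ∀ k, Bad k → k ≤ K := by
    rintro k ⟨e, he, hb⟩
    rw [hK, Nat.le_floor_iff (by positivity), le_div_iff₀ hη0]
    have h1 : (k:ℝ) * (η * n) ≤ 𝔼 x, ∑ i, (inner ℝ (e i) (Φ x)) ^ 2 := by
      rw [Finset.expect_sum_comm]
      calc (k:ℝ) * (η * n) = ∑ i : Fin k, η * n := by simp
        _ ≤ _ := Finset.sum_le_sum fun i _ => (hb i).le
    have h2 : 𝔼 x, ∑ i, (inner ℝ (e i) (Φ x)) ^ 2 ≤ n := by
      refine Finset.expect_le Finset.univ_nonempty fun x _ => ?_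
      have := he.sum_inner_products_le (x := Φ x) (s := univ)
      simp only [Real.norm_eq_abs, sq_abs] at this
      exact this.trans (hΦ x)
    have : ((k:ℝ) * η) * n ≤ 1 * n := by linarith
    exact le_of_mul_le_mul_right this hV
  obtain ⟨k, hkB, hkmax⟩ : ∃ k, Bad k ∧ ∀ m, Bad m → m ≤ k := by
    have hne : {k | Bad k}.Nonempty := ⟨0, hBad0⟩
    have hbd : BddAbove {k | Bad k} := ⟨K, fun k hk => hbound k hk⟩
    exact ⟨sSup {k | Bad k}, Nat.sSup_mem hne hbd, fun m hm => le_csSup hbd hm⟩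
  have hkK := hbound k hkB
  obtain ⟨e, he, hb⟩ := hkB
  -- unit vectors orthogonal to all `e i` are good
  have hgood1 : ∀ w : E, ‖w‖ = 1 → (∀ i, inner ℝ (e i) w = 0) →
      𝔼 x, (inner ℝ w (Φ x)) ^ 2 ≤ η * n := by
    intro w hw hort
    by_contra hcon
    push Not at hcon
    have : Bad (k+1) := by
      refine ⟨Fin.cons w e, ?_, ?_⟩
      · refine ⟨fun i => ?_, fun i j hij => ?_⟩
        · refine Fin.cases ?_ (fun i => ?_) i
          · simpa using hw
          · simpa using he.1 i
        · induction i using Fin.cases with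
          | zero =>
            induction j using Fin.cases with
            | zero => exact absurd rfl hij
            | succ j => simp only [Fin.cons_zero, Fin.cons_succ]; rw [real_inner_comm]; exact hort j
          | succ i =>
            induction j using Fin.cases with
            | zero => simp only [Fin.cons_zero, Fin.cons_succ]; exact hort i
            | succ j =>
              simp only [Fin.cons_succ]
              exact he.2 (fun h => hij (by rw [h]))
      · intro i
        refine Fin.cases ?_ (fun i => ?_) i
        · simpa using hcon
        · simpa using hb i
    have := hkmax _ this
    omega
  have hgood : ∀ w : E, (∀ i, inner ℝ (e i) w = 0) →
      𝔼 x, (inner ℝ w (Φ x)) ^ 2 ≤ η * n * ‖w‖ ^ 2 := by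
    intro w hort
    by_cases hw : w = 0
    · subst hw; simp
    have hw' : 0 < ‖w‖ := norm_pos_iff.2 hw
    have h1 := hgood1 (‖w‖⁻¹ • w) (by
      rw [norm_smul, norm_inv, norm_norm]; exact inv_mul_cancel₀ hw'.ne') (by
      intro i; rw [inner_smul_right, hort i, mul_zero])
    simp only [inner_smul_left, mul_pow, ← Finset.mul_expect] at h1
    simp only [map_inv₀, RCLike.conj_to_real, inv_pow] at h1
    rw [inv_mul_le_iff₀ (by positivity)] at h1
    linarith
  -- colours
  let z : U → Fin k → ℝ := fun u i => inner ℝ (e i) (F u)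
  have hz : ∀ u i, |z u i| ≤ Real.sqrt n := by
    intro u i
    have h1 := abs_real_inner_le_norm (e i) (F u)
    rw [he.1 i, one_mul] at h1
    exact h1.trans (Real.le_sqrt_of_sq_le (hF u))
  have hsn : 0 < Real.sqrt n := Real.sqrt_pos.2 hV
  let gr : U → Fin k → ℕ := fun u i => ⌊(z u i / Real.sqrt n + 1) * L⌋₊
  have hgr : ∀ u i, gr u i < 4 * L + 1 := by
    intro u i
    have h1 : z u i / Real.sqrt n ≤ 1 := by
      rw [div_le_one hsn]; exact (abs_le.1 (hz u i)).2
    have : (gr u i : ℝ) ≤ 2 * L := by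
      refine (Nat.floor_le ?_).trans ?_
      · have h2 : -1 ≤ z u i / Real.sqrt n := by
          rw [le_div_iff₀ hsn]; have := (abs_le.1 (hz u i)).1; linarith
        exact mul_nonneg (by linarith) hLpos.le
      · exact mul_le_mul_of_nonneg_right (by linarith) hLpos.le
    have : gr u i ≤ 2 * L := by exact_mod_cast this
    omega
  let gc : U → (Fin k → Fin (4 * L + 1)) := fun u i => ⟨gr u i, hgr u i⟩
  have hcardle : Fintype.card (Fin k → Fin (4 * L + 1)) ≤ ∑ k ∈ Finset.range (K+1), (4 * L + 1) ^ k := by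
    rw [Fintype.card_fun, Fintype.card_fin, Fintype.card_fin]
    exact Finset.single_le_sum (f := fun k => (4 * L + 1) ^ k) (fun _ _ => Nat.zero_le _)
      (Finset.mem_range.2 (by omega))
  refine ⟨fun u => Fin.castLE hcardle ((Fintype.equivFin _) (gc u)), ?_⟩
  intro u u' huu
  have hgc : gc u = gc u' := (Fintype.equivFin _).injective (Fin.castLE_injective _ huu)
  have hclose : ∀ i, |z u i - z u' i| ≤ Real.sqrt n / L := by
    intro i
    have h1 : gr u i = gr u' i := by
      have := congrFun hgc i
      exact congrArg Fin.val this
    have hnn : ∀ u, 0 ≤ (z u i / Real.sqrt n + 1) * L := by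
      intro u
      have h2 : -1 ≤ z u i / Real.sqrt n := by
        rw [le_div_iff₀ hsn]; have := (abs_le.1 (hz u i)).1; linarith
      exact mul_nonneg (by linarith) hLpos.le
    have a1 := Nat.floor_le (hnn u)
    have a2 := Nat.floor_le (hnn u')
    have b1 := Nat.lt_floor_add_one ((z u i / Real.sqrt n + 1) * L)
    have b2 := Nat.lt_floor_add_one ((z u' i / Real.sqrt n + 1) * L)
    have h1' : (⌊(z u i / Real.sqrt n + 1) * L⌋₊ : ℝ) = ⌊(z u' i / Real.sqrt n + 1) * L⌋₊ := by
      exact_mod_cast h1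
    have h3 : |(z u i - z u' i) * (L / Real.sqrt n)| ≤ 1 := by
      have : (z u i - z u' i) * (L / Real.sqrt n) =
        (z u i / Real.sqrt n + 1) * L - (z u' i / Real.sqrt n + 1) * L := by ring
      rw [this, abs_le]
      constructor <;> linarith
    rw [abs_mul, abs_of_pos (div_pos hLpos hsn)] at h3
    rw [le_div_iff₀ hLpos]
    have h4 := mul_le_mul_of_nonneg_right h3 hsn.le
    have h5 : |z u i - z u' i| * (L / Real.sqrt n) * Real.sqrt n = |z u i - z u' i| * L := by
      field_simp
    linarith
  -- decomposition
  set d : E := F u - F u' with hd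
  set P : E := ∑ i, (inner ℝ (e i) d) • e i with hP
  have hPi : ∀ i, inner ℝ (e i) P = inner ℝ (e i) d := by
    intro i
    rw [hP, he.inner_right_fintype]
  have hort : ∀ i, inner ℝ (e i) (d - P) = 0 := by
    intro i; rw [inner_sub_right, hPi, sub_self]
  have hPd : inner ℝ (d - P) P = 0 := by
    have hh : inner ℝ (d - P) (∑ i, (inner ℝ (e i) d) • e i) = 0 := by
      rw [inner_sum]
      refine Finset.sum_eq_zero fun i _ => ?_
      rw [inner_smul_right, real_inner_comm (e i) (d - P), hort, mul_zero]
    exact hh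
  have hPn : ‖P‖ ^ 2 = ∑ i, (inner ℝ (e i) d) ^ 2 := by
    rw [← real_inner_self_eq_norm_sq]
    nth_rewrite 1 [hP]
    rw [sum_inner]
    refine Finset.sum_congr rfl fun i _ => ?_
    rw [inner_smul_left, hPi]; simp [sq]
  have hPn' : ‖P‖ ^ 2 ≤ K * (n / L ^ 2) := by
    rw [hPn]
    calc ∑ i, (inner ℝ (e i) d) ^ 2 ≤ ∑ i : Fin k, n / L ^ 2 := by
          refine Finset.sum_le_sum fun i _ => ?_
          have h1 : inner ℝ (e i) d = z u i - z u' i := by rw [hd, inner_sub_right]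
          rw [h1, ← sq_abs]
          have := pow_le_pow_left₀ (abs_nonneg _) (hclose i) 2
          rwa [div_pow, Real.sq_sqrt hV.le] at this
      _ = k * (n / L ^ 2) := by simp
      _ ≤ _ := mul_le_mul_of_nonneg_right (by exact_mod_cast hkK) (by positivity)
  have hdn : ‖d‖ ^ 2 ≤ 4 * n := by
    have h1 : ‖d‖ ≤ ‖F u‖ + ‖F u'‖ := norm_sub_le _ _
    have h2 := hF u
    have h3 := hF u'
    nlinarith [norm_nonneg (F u), norm_nonneg (F u'), norm_nonneg d, sq_nonneg (‖F u‖ - ‖F u'‖)]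
  have hwn : ‖d - P‖ ^ 2 ≤ 4 * n := by
    have : ‖d‖ ^ 2 = ‖d - P‖ ^ 2 + ‖P‖ ^ 2 := by
      have h1 := norm_add_sq_real (d - P) P
      rw [sub_add_cancel, hPd] at h1
      linarith
    nlinarith [sq_nonneg ‖P‖]
  have hmain : 𝔼 x, (inner ℝ d (Φ x)) ^ 2 ≤ ε * n ^ 2 := by
    have h1 : ∀ x, (inner ℝ d (Φ x)) ^ 2 ≤ 2 * (n * ‖P‖ ^ 2) + 2 * (inner ℝ (d - P) (Φ x)) ^ 2 := by
      intro x
      have h2 : inner ℝ d (Φ x) = inner ℝ P (Φ x) + inner ℝ (d - P) (Φ x) := by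
        rw [← inner_add_left]; congr 1; abel
      have h3 : (inner ℝ P (Φ x)) ^ 2 ≤ n * ‖P‖ ^ 2 := by
        have h4 := abs_real_inner_le_norm P (Φ x)
        have h5 := pow_le_pow_left₀ (abs_nonneg _) h4 2
        rw [sq_abs, mul_pow] at h5
        nlinarith [hΦ x, sq_nonneg ‖P‖]
      rw [h2]
      nlinarith [sq_nonneg (inner ℝ P (Φ x) - inner ℝ (d - P) (Φ x))]
    refine le_trans (Finset.expect_le_expect fun x _ => h1 x) ?_
    rw [Finset.expect_add_distrib, Fintype.expect_const, ← Finset.mul_expect]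
    have h6 := hgood (d - P) hort
    have h7 : η * n * ‖d - P‖ ^ 2 ≤ η * n * (4 * n) := mul_le_mul_of_nonneg_left hwn (by positivity)
    have h8 : n * ‖P‖ ^ 2 ≤ n * (K * (n / L ^ 2)) := mul_le_mul_of_nonneg_left hPn' hV.le
    have h9 : (K:ℝ) / L ^ 2 ≤ ε / 16 := by
      have hL1 : 16 * ((K:ℝ) + 1) / ε < L := by linarith
      rw [div_lt_iff₀ hε] at hL1
      have hL2 : (1:ℝ) ≤ L := by
        have : 0 < 16 * ((K:ℝ) + 1) / ε := by positivity
        linarith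
      rw [div_le_iff₀ (by positivity)]
      have : (L:ℝ) * ε ≤ L ^ 2 * ε := mul_le_mul_of_nonneg_right (by nlinarith) hε.le
      linarith
    have h10 : n * (K * (n / L ^ 2)) = (K / L ^ 2) * n ^ 2 := by ring
    have h11 : (K / L ^ 2 : ℝ) * n ^ 2 ≤ ε / 16 * n ^ 2 := mul_le_mul_of_nonneg_right h9 (by positivity)
    have h12 : η * n * (4 * n) = ε / 4 * n ^ 2 := by rw [hη]; ring
    have : 0 ≤ ε * n ^ 2 := by positivity
    linarith
  have hfin : ∀ x, (𝔼 v, (f u v - f u' v) * φ x v) ^ 2 = (inner ℝ d (Φ x)) ^ 2 / n ^ 2 := by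
    intro x
    have h0 : inner ℝ d (Φ x) = ∑ v, (f u v - f u' v) * φ x v := by
      refine (PiLp.inner_apply d (Φ x)).trans (Finset.sum_congr rfl fun v _ => ?_)
      change inner ℝ (f u v - f u' v) (φ x v) = _
      simp [mul_comm]
    rw [Fintype.expect_eq_sum_div_card, div_pow, h0]
  simp only [hfin, ← Finset.expect_div]
  rw [div_le_iff₀ (by positivity)]
  exact hmain

end CTcover

section CTtele
open Finset
open scoped BigOperators Classical

lemma ctClq_insertNth {V : Type*} (G : SimpleGraph V) {s : ℕ} (j : Fin (s+1)) (v : V)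
    (y : Fin s → V) : ctClq G (Fin.insertNth j v y : Fin (s+1) → V) ↔
      ctClq G y ∧ ∀ i, G.Adj (y i) v := by
  constructor
  · intro h
    refine ⟨fun i k hik => ?_, fun i => ?_⟩
    · have := h (j.succAbove i) (j.succAbove k) (fun e => hik (Fin.succAbove_right_injective e))
      simpa using this
    · have := h (j.succAbove i) j (Fin.succAbove_ne j i)
      simpa using this
  · rintro ⟨h1, h2⟩ i k hik
    rcases Fin.eq_self_or_eq_succAbove j i with rfl | ⟨i, rfl⟩
    · rcases Fin.eq_self_or_eq_succAbove i k with rfl | ⟨k, rfl⟩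
      · exact absurd rfl hik
      · simpa using (h2 k).symm
    · rcases Fin.eq_self_or_eq_succAbove j k with rfl | ⟨k, rfl⟩
      · simpa using h2 i
      · simpa using h1 i k (fun e => hik (by rw [e]))

lemma ct_tele {V : Type*} [Fintype V] [Nonempty V] (G : SimpleGraph V) (s : ℕ) (a b : V → ℝ) (K : ℝ)
    (hK : 0 ≤ K) (ha : ∀ v, |a v| ≤ K) (hb : ∀ v, |b v| ≤ K) (η : ℝ)
    (hη : 𝔼 y : Fin s → V, |𝔼 v, (a v - b v) * ctInd (∀ i, G.Adj (y i) v)| ≤ η)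
    (J : Finset (Fin (s+1))) :
    |𝔼 x : Fin (s+1) → V, ctInd (ctClq G x) * ∏ i, (if i ∈ J then a (x i) else b (x i)) -
      𝔼 x : Fin (s+1) → V, ctInd (ctClq G x) * ∏ i, b (x i)| ≤ J.card * (K ^ s * η) := by
  induction J using Finset.induction_on with
  | empty => simp
  | insert j J hj ih =>
    rw [Finset.card_insert_of_notMem hj]
    have key : |𝔼 x : Fin (s+1) → V, ctInd (ctClq G x) *
          ∏ i, (if i ∈ insert j J then a (x i) else b (x i)) -
        𝔼 x : Fin (s+1) → V, ctInd (ctClq G x) * ∏ i, (if i ∈ J then a (x i) else b (x i))|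
        ≤ K ^ s * η := by
      rw [← Finset.expect_sub_distrib, ct_insertNth j, Finset.expect_comm]
      have h1 : ∀ (y : Fin s → V) (v : V),
          ctInd (ctClq G (Fin.insertNth j v y : Fin (s+1) → V)) *
            ∏ i, (if i ∈ insert j J then a ((Fin.insertNth j v y : Fin (s+1) → V) i)
              else b ((Fin.insertNth j v y : Fin (s+1) → V) i)) -
          ctInd (ctClq G (Fin.insertNth j v y : Fin (s+1) → V)) *
            ∏ i, (if i ∈ J then a ((Fin.insertNth j v y : Fin (s+1) → V) i)
              else b ((Fin.insertNth j v y : Fin (s+1) → V) i)) =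
          (ctInd (ctClq G y) * ∏ i : Fin s, (if j.succAbove i ∈ J then a (y i) else b (y i))) *
            ((a v - b v) * ctInd (∀ i, G.Adj (y i) v)) := by
        intro y v
        rw [ctInd_congr (ctClq_insertNth G j v y), ctInd_and]
        rw [Fin.prod_univ_succAbove _ j, Fin.prod_univ_succAbove _ j]
        simp only [Fin.insertNth_apply_same, Fin.insertNth_apply_succAbove, hj,
          Finset.mem_insert, Fin.succAbove_ne, if_true, if_false, false_or, true_or]
        ring
      simp only [h1, ← Finset.mul_expect]
      refine (Finset.abs_expect_le _ _).trans ?_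
      refine le_trans ?_ (mul_le_mul_of_nonneg_left hη (pow_nonneg hK s))
      rw [Finset.mul_expect]
      refine Finset.expect_le_expect fun y _ => ?_
      rw [abs_mul]
      refine mul_le_mul_of_nonneg_right ?_ (abs_nonneg _)
      rw [abs_mul, Finset.abs_prod]
      have h2 : ∏ i : Fin s, |if j.succAbove i ∈ J then a (y i) else b (y i)| ≤ K ^ s := by
        calc _ ≤ ∏ i : Fin s, K := Finset.prod_le_prod (fun _ _ => abs_nonneg _) (fun i _ => by
              split_ifs
              · exact ha _
              · exact hb _)
          _ = K ^ s := by simp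
      calc _ ≤ 1 * K ^ s := mul_le_mul (ctInd_abs _) h2 (Finset.prod_nonneg fun _ _ => abs_nonneg _) zero_le_one
        _ = K ^ s := one_mul _
    have := abs_sub_le (𝔼 x : Fin (s+1) → V, ctInd (ctClq G x) *
          ∏ i, (if i ∈ insert j J then a (x i) else b (x i)))
        (𝔼 x : Fin (s+1) → V, ctInd (ctClq G x) * ∏ i, (if i ∈ J then a (x i) else b (x i)))
        (𝔼 x : Fin (s+1) → V, ctInd (ctClq G x) * ∏ i, b (x i))
    push_cast
    linarith

lemma ct_abs_sqrt {Ω : Type*} [Fintype Ω] [Nonempty Ω] (g : Ω → ℝ) (e : ℝ)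
    (h : 𝔼 y, (g y) ^ 2 ≤ e) : 𝔼 y, |g y| ≤ Real.sqrt e := by
  apply Real.le_sqrt_of_sq_le
  refine (ct_jensen (fun y => |g y|) (fun _ => abs_nonneg _) 2).trans ?_
  simpa using h

lemma ct_union_dens {V : Type*} [Fintype V] [Nonempty V] (G : SimpleGraph V) (s : ℕ) (u u' : V) (e : ℝ)
    (h : 𝔼 y : Fin s → V, (𝔼 v, (ctInd (G.Adj u v) - ctInd (G.Adj u' v)) *
      ctInd (∀ i, G.Adj (y i) v)) ^ 2 ≤ e) :
    ctDens (fun x : Fin (s+1) → V => ctClq G x ∧ ∀ i, (G.Adj u (x i) ∨ G.Adj u' (x i))) ≤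
      2 ^ (s+1) * ctDens (fun x : Fin (s+1) → V => ctClq G x ∧ ∀ i, G.Adj u (x i)) +
      (s+1) * (2 ^ s * Real.sqrt e) := by
  have h1 := ct_tele G s (fun v => ctInd (G.Adj u v) + ctInd (G.Adj u' v))
    (fun v => 2 * ctInd (G.Adj u v)) 2 (by norm_num)
    (fun v => by
      rw [abs_of_nonneg (add_nonneg (ctInd_nonneg _) (ctInd_nonneg _))]
      linarith [ctInd_le_one (G.Adj u v), ctInd_le_one (G.Adj u' v)])
    (fun v => by
      rw [abs_of_nonneg (mul_nonneg (by norm_num) (ctInd_nonneg _))]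
      linarith [ctInd_le_one (G.Adj u v)]) (Real.sqrt e) (by
      apply ct_abs_sqrt
      refine le_trans (le_of_eq ?_) h
      refine Finset.expect_congr rfl fun y _ => ?_
      have : ∀ v, (ctInd (G.Adj u v) + ctInd (G.Adj u' v) - 2 * ctInd (G.Adj u v)) *
          ctInd (∀ i, G.Adj (y i) v) = - ((ctInd (G.Adj u v) - ctInd (G.Adj u' v)) *
          ctInd (∀ i, G.Adj (y i) v)) := fun v => by ring
      simp only [this, Finset.expect_neg_distrib, neg_sq]) univ
  simp only [Finset.mem_univ, if_true, Finset.card_univ, Fintype.card_fin] at h1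
  have h2 : 𝔼 x : Fin (s+1) → V, ctInd (ctClq G x) * ∏ i, (2 * ctInd (G.Adj u (x i))) =
      2 ^ (s+1) * ctDens (fun x : Fin (s+1) → V => ctClq G x ∧ ∀ i, G.Adj u (x i)) := by
    unfold ctDens
    rw [Finset.mul_expect]
    refine Finset.expect_congr rfl fun x _ => ?_
    rw [ctInd_and, ← ctInd_forall, Finset.prod_mul_distrib]
    simp; ring
  have h3 : ctDens (fun x : Fin (s+1) → V => ctClq G x ∧ ∀ i, (G.Adj u (x i) ∨ G.Adj u' (x i))) ≤
      𝔼 x : Fin (s+1) → V, ctInd (ctClq G x) *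
        ∏ i, (ctInd (G.Adj u (x i)) + ctInd (G.Adj u' (x i))) := by
    unfold ctDens
    refine Finset.expect_le_expect fun x _ => ?_
    rw [ctInd_and, ← ctInd_forall]
    exact mul_le_mul_of_nonneg_left (Finset.prod_le_prod (fun _ _ => ctInd_nonneg _)
      fun i _ => ctInd_or_le _ _) (ctInd_nonneg _)
  rw [h2] at h1
  have := (abs_le.1 h1).2
  push_cast at this
  linarith

end CTtele

section CTms
open Finset
open scoped BigOperators Classical

/-- The quadratic functional of Motzkin–Straus type with linear term `b`. -/
noncomputable def ctF {ι : Type*} [Fintype ι] (Γ : SimpleGraph ι) (b w : ι → ℝ) : ℝ :=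
  1 / 2 * ∑ i, ∑ j, ctInd (Γ.Adj i j) * (w i * w j) + ∑ i, b i * w i

lemma ct_single_sum {ι : Type*} [Fintype ι] (i j : ι) (g : ι → ℝ) :
    ∑ k, ((Pi.single i 1 - Pi.single j 1 : ι → ℝ) k) * g k = g i - g j := by
  simp [sub_mul, Finset.sum_sub_distrib, Pi.single_apply]

lemma ctF_shift {ι : Type*} [Fintype ι] (Γ : SimpleGraph ι) (b w : ι → ℝ) (i j : ι)
    (hij : ¬ Γ.Adj i j) (t : ℝ) :
    ctF Γ b (fun k => w k + t * (Pi.single i 1 - Pi.single j 1 : ι → ℝ) k) = ctF Γ b w +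
      t * ((∑ l, ctInd (Γ.Adj i l) * w l + b i) - (∑ l, ctInd (Γ.Adj j l) * w l + b j)) := by
  set d : ι → ℝ := Pi.single i 1 - Pi.single j 1 with hd
  have hs : ∀ g : ι → ℝ, ∑ k, d k * g k = g i - g j := ct_single_sum i j
  have hsymm : ∀ k l, ctInd (Γ.Adj k l) = ctInd (Γ.Adj l k) := fun k l => ctInd_congr (Γ.adj_comm k l)
  have e1 : ∑ k, ∑ l, ctInd (Γ.Adj k l) * ((w k + t * d k) * (w l + t * d l)) =
      ∑ k, ∑ l, ctInd (Γ.Adj k l) * (w k * w l) +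
      t * (∑ k, d k * (∑ l, ctInd (Γ.Adj k l) * w l)) +
      t * (∑ k, ∑ l, d l * (ctInd (Γ.Adj l k) * w k)) +
      t ^ 2 * ∑ k, d k * ∑ l, d l * ctInd (Γ.Adj k l) := by
    simp only [Finset.mul_sum, ← Finset.sum_add_distrib]
    refine Finset.sum_congr rfl fun k _ => Finset.sum_congr rfl fun l _ => ?_
    rw [hsymm l k]
    ring
  have e2 : ∑ k, ∑ l, d l * (ctInd (Γ.Adj l k) * w k) = ∑ l, d l * (∑ k, ctInd (Γ.Adj l k) * w k) := by
    rw [Finset.sum_comm]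
    simp only [Finset.mul_sum]
  unfold ctF
  rw [e1, e2]
  simp only [hs]
  have e3 : ∑ k, b k * (w k + t * d k) = ∑ k, b k * w k + t * (b i - b j) := by
    rw [← hs b, Finset.mul_sum, ← Finset.sum_add_distrib]
    exact Finset.sum_congr rfl fun k _ => by ring
  rw [e3, ctInd_false (hij), ctInd_false (Γ.loopless.irrefl i), ctInd_false (Γ.loopless.irrefl j), hsymm j i,
    ctInd_false hij]
  ring

lemma ctF_reduce {ι : Type*} [Fintype ι] (Γ : SimpleGraph ι) (b : ι → ℝ) (Φ : ℝ)
    (hcl : ∀ w : ι → ℝ, (∀ i, 0 ≤ w i) → ∑ i, w i = 1 →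
      (∀ i j, i ≠ j → w i ≠ 0 → w j ≠ 0 → Γ.Adj i j) → ctF Γ b w ≤ Φ) (k : ℕ) :
    ∀ w : ι → ℝ, (∀ i, 0 ≤ w i) → ∑ i, w i = 1 → (univ.filter (fun i => w i ≠ 0)).card ≤ k →
      ctF Γ b w ≤ Φ := by
  induction k with
  | zero =>
    intro w hw hs hk
    refine hcl w hw hs fun i j _ hi _ => ?_
    have : i ∈ univ.filter (fun i => w i ≠ 0) := by simpa using hi
    rw [Finset.card_eq_zero.1 (Nat.le_zero.1 hk)] at this
    simp at this
  | succ k ih =>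
    intro w hw hs hk
    by_cases hc : ∀ i j, i ≠ j → w i ≠ 0 → w j ≠ 0 → Γ.Adj i j
    · exact hcl w hw hs hc
    push Not at hc
    obtain ⟨i, j, hne, hi, hj, hadj⟩ := hc
    -- it suffices to treat an ordered pair
    have main : ∀ i j, i ≠ j → w i ≠ 0 → w j ≠ 0 → ¬ Γ.Adj i j →
        0 ≤ ((∑ l, ctInd (Γ.Adj i l) * w l + b i) - (∑ l, ctInd (Γ.Adj j l) * w l + b j)) →
        ctF Γ b w ≤ Φ := by
      intro i j hne hi hj hadj hL
      have hsh := ctF_shift Γ b w i j hadj (w j)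
      set w' : ι → ℝ := fun k => w k + w j * (Pi.single i 1 - Pi.single j 1 : ι → ℝ) k with hw'
      have hj' : w' j = 0 := by simp [hw', Pi.single_apply, hne.symm]
      have hi' : w' i = w i + w j := by simp [hw', Pi.single_apply, hne]
      have ho : ∀ l, l ≠ i → l ≠ j → w' l = w l := by
        intro l h1 h2; simp [hw', Pi.single_apply, h1, h2]
      have hnn : ∀ l, 0 ≤ w' l := by
        intro l
        by_cases h1 : l = i
        · subst h1; rw [hi']; exact add_nonneg (hw _) (hw _)
        by_cases h2 : l = j
        · subst h2; rw [hj']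
        rw [ho l h1 h2]; exact hw l
      have hsum : ∑ l, w' l = 1 := by
        have h3 := ct_single_sum i j (fun _ => (1:ℝ))
        simp only [mul_one, sub_self] at h3
        simp only [hw']
        rw [Finset.sum_add_distrib, ← Finset.mul_sum, h3, hs]; ring
      have hcard : (univ.filter (fun i => w' i ≠ 0)).card ≤ k := by
        have hss : univ.filter (fun i => w' i ≠ 0) ⊂ univ.filter (fun i => w i ≠ 0) := by
          rw [Finset.ssubset_iff_of_subset]
          · exact ⟨j, by simpa using hj, by simpa using hj'⟩
          · intro l hl
            simp only [Finset.mem_filter, Finset.mem_univ, true_and] at hl ⊢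
            by_cases h1 : l = i
            · subst h1; exact hi
            by_cases h2 : l = j
            · subst h2; exact hj
            rwa [ho l h1 h2] at hl
        have := Finset.card_lt_card hss
        omega
      have := ih w' hnn hsum hcard
      have h5 := mul_nonneg (hw j) hL
      linarith
    rcases le_total 0 ((∑ l, ctInd (Γ.Adj i l) * w l + b i) - (∑ l, ctInd (Γ.Adj j l) * w l + b j)) with h | h
    · exact main i j hne hi hj hadj h
    · exact main j i hne.symm hj hi (fun h => hadj h.symm) (by linarith)

lemma ct_ms {ι : Type*} [Fintype ι] (Γ : SimpleGraph ι) (P Q : ι → Prop) (S : ℕ) (c μ δ : ℝ)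
    (hc : 0 ≤ c) (hμ : 0 ≤ μ) (h1 : (S + 1) * c + μ * (S - 1 / 2) = 1)
    (h2 : c * (S - 1 / 2) + μ * (S - 3 / 4) = δ)
    (k1 : ∀ K : Finset ι, (∀ i ∈ K, ∀ j ∈ K, i ≠ j → Γ.Adj i j) → K.card ≤ S + 1)
    (k2 : ∀ K : Finset ι, (∀ i ∈ K, ∀ j ∈ K, i ≠ j → Γ.Adj i j) → (∀ i ∈ K, P i ∨ Q i) → K.card ≤ S)
    (k3 : ∀ K : Finset ι, (∀ i ∈ K, ∀ j ∈ K, i ≠ j → Γ.Adj i j) → (∀ i ∈ K, P i ∧ Q i) →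
      K.card + 1 ≤ S)
    (w : ι → ℝ) (hw : ∀ i, 0 ≤ w i) (hs : ∑ i, w i = 1) :
    ctF Γ (fun i => μ * ((ctInd (P i) + ctInd (Q i)) / 2)) w ≤ 1 / 2 - c / 2 + μ * δ / 2 := by
  refine ctF_reduce Γ _ _ ?_ _ w hw hs le_rfl
  clear hw hs w
  intro w hw hs hcl
  set K := univ.filter (fun i => w i ≠ 0) with hK
  have hKm : ∀ i, i ∈ K ↔ w i ≠ 0 := fun i => by simp [hK]
  set D : ι → ℝ := fun i => (ctInd (P i) + ctInd (Q i)) / 2 with hD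
  have e1 : ∑ i, ∑ j, ctInd (Γ.Adj i j) * (w i * w j) = 1 - ∑ i, w i ^ 2 := by
    have : ∀ i j, ctInd (Γ.Adj i j) * (w i * w j) = w i * w j - if i = j then w i * w j else 0 := by
      intro i j
      by_cases hij : i = j
      · subst hij; rw [ctInd_false (Γ.loopless.irrefl i)]; simp
      · by_cases hi : w i = 0
        · simp [hi]
        by_cases hj : w j = 0
        · simp [hj]
        rw [ctInd_true (hcl i j hij hi hj)]; simp [hij]
    simp only [this, Finset.sum_sub_distrib, ← Finset.mul_sum, hs]
    simp [hs, sq]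
  have e2 : ∑ i ∈ K, (w i - (c + μ * D i)) ^ 2 = ∑ i, w i ^ 2 - 2 * (c + ∑ i, μ * D i * w i) +
      ∑ i ∈ K, (c + μ * D i) ^ 2 := by
    have f1 : ∑ i, w i ^ 2 = ∑ i ∈ K, w i ^ 2 := by
      symm
      refine Finset.sum_subset (Finset.subset_univ _) fun i _ hi => ?_
      have : w i = 0 := by simpa [hKm] using hi
      simp [this]
    have f2 : c + ∑ i, μ * D i * w i = ∑ i ∈ K, (c + μ * D i) * w i := by
      have : ∑ i ∈ K, (c + μ * D i) * w i = ∑ i, (c + μ * D i) * w i := by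
        refine Finset.sum_subset (Finset.subset_univ _) fun i _ hi => ?_
        have : w i = 0 := by simpa [hKm] using hi
        simp [this]
      rw [this]
      simp only [add_mul, Finset.sum_add_distrib]
      rw [← Finset.mul_sum, hs, mul_one]
    rw [f1, f2, Finset.mul_sum, ← Finset.sum_sub_distrib, ← Finset.sum_add_distrib]
    exact Finset.sum_congr rfl fun i _ => by ring
  have e3 : ∑ i ∈ K, (c + μ * D i) ^ 2 ≤ c + μ * δ := by
    have f1 : ∀ i, (c + μ * D i) ^ 2 = c ^ 2 + ((c + μ / 2) ^ 2 - c ^ 2) * ctInd (P i ∨ Q i) +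
        ((c + μ) ^ 2 - (c + μ / 2) ^ 2) * ctInd (P i ∧ Q i) := by
      intro i
      simp only [hD]
      by_cases hp : P i <;> by_cases hq : Q i <;> simp [ctInd, hp, hq] <;> ring
    simp only [f1, Finset.sum_add_distrib, ← Finset.mul_sum, ctInd_sum, Finset.sum_const,
      nsmul_eq_mul]
    have hKcl : ∀ i ∈ K, ∀ j ∈ K, i ≠ j → Γ.Adj i j := fun i hi j hj hij =>
      hcl i j hij ((hKm i).1 hi) ((hKm j).1 hj)
    have g1 : (K.card : ℝ) ≤ S + 1 := by exact_mod_cast k1 K hKcl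
    have g2 : ((K.filter (fun i => P i ∨ Q i)).card : ℝ) ≤ S := by
      exact_mod_cast k2 (K.filter (fun i => P i ∨ Q i)) (fun i hi j hj =>
        hKcl i (Finset.mem_filter.1 hi).1 j (Finset.mem_filter.1 hj).1)
        (fun i hi => (Finset.mem_filter.1 hi).2)
    have g3 : ((K.filter (fun i => P i ∧ Q i)).card : ℝ) + 1 ≤ S := by
      exact_mod_cast k3 (K.filter (fun i => P i ∧ Q i)) (fun i hi j hj =>
        hKcl i (Finset.mem_filter.1 hi).1 j (Finset.mem_filter.1 hj).1)
        (fun i hi => (Finset.mem_filter.1 hi).2)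
    have x1 : 0 ≤ (c + μ / 2) ^ 2 - c ^ 2 := by nlinarith
    have x2 : 0 ≤ (c + μ) ^ 2 - (c + μ / 2) ^ 2 := by nlinarith
    have y1 := mul_le_mul_of_nonneg_right g1 (sq_nonneg c)
    have y2 := mul_le_mul_of_nonneg_left g2 x1
    have y3 := mul_le_mul_of_nonneg_left (le_sub_iff_add_le.2 g3) x2
    have z : ((S:ℝ) + 1) * c ^ 2 + ((c + μ / 2) ^ 2 - c ^ 2) * S +
      ((c + μ) ^ 2 - (c + μ / 2) ^ 2) * (S - 1) = c + μ * δ := by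
      rw [← h2]
      linear_combination c * h1
    linarith
  have e4 : 0 ≤ ∑ i ∈ K, (w i - (c + μ * D i)) ^ 2 := Finset.sum_nonneg fun i _ => sq_nonneg _
  unfold ctF
  rw [e1]
  linarith

end CTms

section CTtri
open Finset
open scoped BigOperators Classical

lemma ct_samp {V : Type*} [Fintype V] [Nonempty V] (M k : ℕ) (p : (Fin k → V) → Prop) :
    𝔼 s : Fin M → V, ctInd (∃ e : Fin k ↪ Fin M, p (s ∘ e)) ≤
      Fintype.card (Fin k ↪ Fin M) * ctDens p := by
  refine (Finset.expect_le_expect fun s _ => ctInd_exists_le _).trans ?_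
  rw [Finset.expect_sum_comm]
  have : ∀ e : Fin k ↪ Fin M, 𝔼 s : Fin M → V, ctInd (p (s ∘ e)) = ctDens p := fun e =>
    ct_marg e e.injective (fun x => ctInd (p x))
  simp [this]

lemma ct_emb_of_card {ι : Type*} (K : Finset ι) (k : ℕ) (h : k ≤ K.card) :
    ∃ e : Fin k ↪ ι, ∀ i, e i ∈ K := by
  obtain ⟨f⟩ : Nonempty (Fin k ↪ {x // x ∈ K}) :=
    Function.Embedding.nonempty_of_card_le (by rw [Fintype.card_coe, Fintype.card_fin]; exact h)
  exact ⟨f.trans (Function.Embedding.subtype _), fun i => (f i).2⟩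

lemma ct_expF {V : Type*} [Fintype V] [Nonempty V] (G : SimpleGraph V) (b : V → ℝ) (M : ℕ)
    (hM : 0 < M) :
    𝔼 s : Fin M → V, ctF (G.comap s) (fun i => b (s i)) (fun _ => 1 / (M:ℝ)) =
      1 / 2 * (1 - 1 / M) * (𝔼 u, 𝔼 v, ctInd (G.Adj u v)) + 𝔼 v, b v := by
  have hM' : (M:ℝ) ≠ 0 := by positivity
  unfold ctF
  rw [Finset.expect_add_distrib, ← Finset.mul_expect, Finset.expect_sum_comm, Finset.expect_sum_comm]
  have h1 : ∀ i : Fin M, 𝔼 s : Fin M → V, ∑ j, ctInd ((G.comap s).Adj i j) * (1 / (M:ℝ) * (1 / M)) =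
      (M - 1) * (𝔼 u, 𝔼 v, ctInd (G.Adj u v)) * (1 / (M:ℝ) * (1 / M)) := by
    intro i
    rw [Finset.expect_sum_comm]
    have h2 : ∀ j : Fin M, 𝔼 s : Fin M → V, ctInd ((G.comap s).Adj i j) * (1 / (M:ℝ) * (1 / M)) =
        if j = i then 0 else (𝔼 u, 𝔼 v, ctInd (G.Adj u v)) * (1 / (M:ℝ) * (1 / M)) := by
      intro j
      rw [← Finset.expect_mul]
      split_ifs with hij
      · subst hij
        have : ∀ s : Fin M → V, ctInd ((G.comap s).Adj j j) = 0 := fun s =>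
          ctInd_false ((G.comap s).loopless.irrefl j)
        simp only [this, Finset.expect_const_zero, zero_mul]
      · congr 1
        have h3 := ct_marg (V := V) (![i, j]) (by
          intro x y hxy
          fin_cases x <;> fin_cases y <;> simp_all)
          (fun z => ctInd (G.Adj (z 0) (z 1)))
        simp only [Function.comp_apply, Matrix.cons_val_zero, Matrix.cons_val_one] at h3
        simp only [SimpleGraph.comap_adj]
        rw [h3, ct_cons]
        refine Finset.expect_congr rfl fun u _ => ?_
        rw [ct_cons]
        refine Finset.expect_congr rfl fun v _ => ?_
        exact Fintype.expect_const (ctInd (G.Adj u v))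
    simp only [h2]
    have h5 : ∀ (a : ℝ) (j : Fin M), (if j = i then 0 else a) = a - if j = i then a else 0 := by
      intro a j; split_ifs <;> simp
    simp only [h5, Finset.sum_sub_distrib, Finset.sum_ite_eq', Finset.mem_univ, if_true,
      Finset.sum_const, Finset.card_univ, Fintype.card_fin, nsmul_eq_mul]
    ring
  have h4 : ∀ i : Fin M, 𝔼 s : Fin M → V, b (s i) * (1 / (M:ℝ)) = (𝔼 v, b v) * (1 / M) := by
    intro i
    rw [← Finset.expect_mul]
    congr 1
    have h3 := ct_marg (V := V) (fun _ : Fin 1 => i) (fun x y _ => Subsingleton.elim x y)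
      (fun z => b (z 0))
    simp only [Function.comp_apply] at h3
    rw [h3, ct_cons]
    simp
  simp only [h1, h4, Finset.sum_const, Finset.card_univ, Fintype.card_fin, nsmul_eq_mul]
  field_simp

lemma ct_tri (S : ℕ) (hS : 1 ≤ S) (c μ δ ε : ℝ) (hε : 0 < ε)
    (hc : 0 ≤ c) (hμ : 0 ≤ μ) (h1 : (S + 1) * c + μ * (S - 1 / 2) = 1)
    (h2 : c * (S - 1 / 2) + μ * (S - 3 / 4) = δ) :
    ∃ c1 : ℝ, 0 < c1 ∧ ∀ (V : Type) [Fintype V] [Nonempty V] (G : SimpleGraph V) (P Q : V → Prop),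
      2 * δ ≤ 𝔼 v, (ctInd (P v) + ctInd (Q v)) →
      2 * (1 / 2 - c / 2 - μ * δ / 2 + ε) ≤ 𝔼 u, 𝔼 v, ctInd (G.Adj u v) →
      c1 ≤ ctDens (fun x : Fin (S+2) → V => ctClq G x) ∨
      c1 ≤ ctDens (fun x : Fin (S+1) → V => ctClq G x ∧ ∀ i, (P (x i) ∨ Q (x i))) ∨
      c1 ≤ ctDens (fun x : Fin S → V => ctClq G x ∧ ∀ i, (P (x i) ∧ Q (x i))) := by
  obtain ⟨M, hM⟩ := exists_nat_gt (1 / ε)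
  have hMpos' : (0:ℝ) < M := lt_trans (by positivity) hM
  have hMpos : 0 < M := by exact_mod_cast hMpos'
  have hS' : (1:ℝ) ≤ S := by exact_mod_cast hS
  set N : ℝ := (Fintype.card (Fin (S+2) ↪ Fin M) : ℝ) + Fintype.card (Fin (S+1) ↪ Fin M) +
    Fintype.card (Fin S ↪ Fin M) with hN
  have hN0 : 0 ≤ N := by positivity
  refine ⟨ε / 2 / (1 + μ) / (N + 1), by positivity, ?_⟩
  intro V _ _ G P Q hPQ hE
  set c1 := ε / 2 / (1 + μ) / (N + 1) with hc1
  have hc1pos : 0 < c1 := by positivity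
  by_contra hcon
  push Not at hcon
  obtain ⟨d1, d2, d3⟩ := hcon
  set b : V → ℝ := fun v => μ * ((ctInd (P v) + ctInd (Q v)) / 2) with hb
  let B1 : (Fin M → V) → Prop := fun s => ∃ e : Fin (S+2) ↪ Fin M, ctClq G (s ∘ e)
  let B2 : (Fin M → V) → Prop := fun s => ∃ e : Fin (S+1) ↪ Fin M, ctClq G (s ∘ e) ∧
    ∀ i, (P ((s ∘ e) i) ∨ Q ((s ∘ e) i))
  let B3 : (Fin M → V) → Prop := fun s => ∃ e : Fin S ↪ Fin M, ctClq G (s ∘ e) ∧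
    ∀ i, (P ((s ∘ e) i) ∧ Q ((s ∘ e) i))
  have hcle : c ≤ 1 := by nlinarith
  have hδ0 : 0 ≤ δ := by nlinarith
  have hμδ : 0 ≤ μ * δ := mul_nonneg hμ hδ0
  have hF : ∀ s : Fin M → V, ctF (G.comap s) (fun i => b (s i)) (fun _ => 1 / (M:ℝ)) ≤
      (1 / 2 - c / 2 + μ * δ / 2) + (1 + μ) * (ctInd (B1 s) + (ctInd (B2 s) + ctInd (B3 s))) := by
    intro s
    have hind : ctInd (B1 s ∨ B2 s ∨ B3 s) ≤ ctInd (B1 s) + (ctInd (B2 s) + ctInd (B3 s)) :=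
      (ctInd_or_le _ _).trans (add_le_add_right (ctInd_or_le _ _) _)
    refine le_trans ?_ (add_le_add_right (mul_le_mul_of_nonneg_left hind (by positivity)) _)
    by_cases hbad : B1 s ∨ B2 s ∨ B3 s
    · rw [ctInd_true hbad]
      have : ctF (G.comap s) (fun i => b (s i)) (fun _ => 1 / (M:ℝ)) ≤ 1 / 2 + μ := by
        unfold ctF
        have g1 : ∑ i : Fin M, ∑ j : Fin M, ctInd ((G.comap s).Adj i j) * (1 / (M:ℝ) * (1 / M)) ≤ 1 := by
          calc _ ≤ ∑ i : Fin M, ∑ j : Fin M, 1 * (1 / (M:ℝ) * (1 / M)) :=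
                Finset.sum_le_sum fun i _ => Finset.sum_le_sum fun j _ =>
                  mul_le_mul_of_nonneg_right (ctInd_le_one _) (by positivity)
            _ = 1 := by simp; field_simp
        have g2 : ∑ i : Fin M, b (s i) * (1 / (M:ℝ)) ≤ μ := by
          calc _ ≤ ∑ i : Fin M, μ * (1 / (M:ℝ)) :=
                Finset.sum_le_sum fun i _ => by
                  refine mul_le_mul_of_nonneg_right ?_ (by positivity)
                  rw [hb]
                  have := ctInd_le_one (P (s i))
                  have := ctInd_le_one (Q (s i))
                  exact mul_le_of_le_one_right hμ (by linarith)
            _ = μ := by simp; field_simp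
        linarith
      linarith
    · rw [ctInd_false hbad]
      push Not at hbad
      obtain ⟨n1, n2, n3⟩ := hbad
      rw [mul_zero, add_zero]
      refine ct_ms (G.comap s) (fun i => P (s i)) (fun i => Q (s i)) S c μ δ hc hμ h1 h2 ?_ ?_ ?_ _
        (fun _ => by positivity) (by simp; field_simp)
      · intro K hK
        by_contra hlt
        obtain ⟨e, he⟩ := ct_emb_of_card K (S+2) (by omega)
        exact n1 ⟨e, fun i j hij => hK _ (he i) _ (he j) (fun h => hij (e.injective h))⟩
      · intro K hK hK'
        by_contra hlt
        obtain ⟨e, he⟩ := ct_emb_of_card K (S+1) (by omega)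
        exact n2 ⟨e, fun i j hij => hK _ (he i) _ (he j) (fun h => hij (e.injective h)),
          fun i => hK' _ (he i)⟩
      · intro K hK hK'
        by_contra hlt
        obtain ⟨e, he⟩ := ct_emb_of_card K S (by omega)
        exact n3 ⟨e, fun i j hij => hK _ (he i) _ (he j) (fun h => hij (e.injective h)),
          fun i => hK' _ (he i)⟩
  have hexp := Finset.expect_le_expect (s := univ) fun s _ => hF s
  rw [ct_expF G b M hMpos, Finset.expect_add_distrib, Fintype.expect_const] at hexp
  have hsplit : 𝔼 s : Fin M → V, (1 + μ) * (ctInd (B1 s) + (ctInd (B2 s) + ctInd (B3 s))) =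
      (1 + μ) * (𝔼 s, ctInd (B1 s) + (𝔼 s, ctInd (B2 s) + 𝔼 s, ctInd (B3 s))) := by
    rw [← Finset.mul_expect, Finset.expect_add_distrib, Finset.expect_add_distrib]
  rw [hsplit] at hexp
  have s1 : 𝔼 s, ctInd (B1 s) ≤ _ := ct_samp M (S+2) (fun x : Fin (S+2) → V => ctClq G x)
  have s2 : 𝔼 s, ctInd (B2 s) ≤ _ := ct_samp M (S+1)
    (fun x : Fin (S+1) → V => ctClq G x ∧ ∀ i, (P (x i) ∨ Q (x i)))
  have s3 : 𝔼 s, ctInd (B3 s) ≤ _ := ct_samp M S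
    (fun x : Fin S → V => ctClq G x ∧ ∀ i, (P (x i) ∧ Q (x i)))
  have t1 := s1.trans (mul_le_mul_of_nonneg_left d1.le (Nat.cast_nonneg _))
  have t2 := s2.trans (mul_le_mul_of_nonneg_left d2.le (Nat.cast_nonneg _))
  have t3 := s3.trans (mul_le_mul_of_nonneg_left d3.le (Nat.cast_nonneg _))
  have hsum : 𝔼 s, ctInd (B1 s) + (𝔼 s, ctInd (B2 s) + 𝔼 s, ctInd (B3 s)) ≤ N * c1 := by
    rw [hN]; linarith
  have hlt : (1 + μ) * (N * c1) < ε / 2 := by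
    have : (1 + μ) * ((N + 1) * c1) = ε / 2 := by rw [hc1]; field_simp
    have : 0 < (1 + μ) * c1 := by positivity
    linarith
  have hb' : μ * δ ≤ 𝔼 v, b v := by
    rw [hb, ← Finset.mul_expect, ← Finset.expect_div]
    exact mul_le_mul_of_nonneg_left (by linarith) hμ
  have hle1 : 𝔼 u, 𝔼 v, ctInd (G.Adj u v) ≤ 1 :=
    Finset.expect_le Finset.univ_nonempty fun u _ =>
      Finset.expect_le Finset.univ_nonempty fun v _ => ctInd_le_one _
  have hMi : 1 / (M:ℝ) < ε := by
    rw [div_lt_iff₀ hMpos']; rw [div_lt_iff₀ hε] at hM; linarith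
  have hMi0 : 0 < 1 / (M:ℝ) := by positivity
  have hmul := mul_le_mul_of_nonneg_left hsum (by positivity : 0 ≤ 1 + μ)
  have hk : 1 / (M:ℝ) * (𝔼 u, 𝔼 v, ctInd (G.Adj u v)) ≤ 1 / (M:ℝ) := mul_le_of_le_one_right hMi0.le hle1
  have hexpand : 1 / 2 * (1 - 1 / (M:ℝ)) * (𝔼 u, 𝔼 v, ctInd (G.Adj u v)) =
    1 / 2 * (𝔼 u, 𝔼 v, ctInd (G.Adj u v)) - 1 / 2 * (1 / (M:ℝ) * (𝔼 u, 𝔼 v, ctInd (G.Adj u v))) := by ring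
  linarith

end CTtri

section CTsparse
open Finset
open scoped BigOperators Classical

lemma ct_edge_dens {V : Type*} [Fintype V] [Nonempty V] (S : Finset V) (C : ℕ) (hC : 1 ≤ C)
    (hn : 4 * C ≤ Fintype.card V) (hS : Fintype.card V ≤ 2 * C * S.card) :
    𝔼 p : V × V, ctInd (¬ (p.1 ∈ S ∧ p.2 ∈ S ∧ p.1 ≠ p.2)) ≤ 1 - 1 / (8 * (C:ℝ) ^ 2) := by
  have h1 : ∀ p : V × V, ctInd (¬ (p.1 ∈ S ∧ p.2 ∈ S ∧ p.1 ≠ p.2)) =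
      1 - ctInd (p.1 ∈ S ∧ p.2 ∈ S ∧ p.1 ≠ p.2) := by
    intro p; unfold ctInd; split_ifs <;> simp_all
  simp only [h1]
  rw [Finset.expect_sub_distrib, Fintype.expect_const]
  have h2 : 𝔼 p : V × V, ctInd (p.1 ∈ S ∧ p.2 ∈ S ∧ p.1 ≠ p.2) =
      ((S.card * S.card - S.card : ℕ) : ℝ) / (Fintype.card V * Fintype.card V) := by
    have := ctDens_card (fun p : V × V => p.1 ∈ S ∧ p.2 ∈ S ∧ p.1 ≠ p.2)
    unfold ctDens at this
    rw [this, ← Finset.offDiag_card]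
    congr 1
    · congr 2; ext p; simp [Finset.mem_offDiag]
    · simp
  rw [h2]
  have hc2 : 2 ≤ S.card := by
    have : 2 * C * 2 ≤ 2 * C * S.card := by linarith
    exact Nat.le_of_mul_le_mul_left this (by omega)
  have hle : S.card ≤ S.card * S.card := Nat.le_mul_self _
  rw [Nat.cast_sub hle]
  push_cast
  have hV : (0:ℝ) < Fintype.card V := by exact_mod_cast Fintype.card_pos
  have hCr : (1:ℝ) ≤ C := by exact_mod_cast hC
  have hS' : (Fintype.card V : ℝ) ≤ 2 * C * S.card := by exact_mod_cast hS
  have hc2' : (2:ℝ) ≤ S.card := by exact_mod_cast hc2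
  have : 1 / (8 * (C:ℝ) ^ 2) ≤ ((S.card:ℝ) * S.card - S.card) / (Fintype.card V * Fintype.card V) := by
    rw [div_le_div_iff₀ (by positivity) (by positivity)]
    have e1 : (Fintype.card V : ℝ) * Fintype.card V ≤ (2 * C * S.card) * (2 * C * S.card) :=
      mul_le_mul hS' hS' hV.le (by positivity)
    have e2 : (C:ℝ) ^ 2 * (S.card * 2) ≤ (C:ℝ) ^ 2 * (S.card * S.card) := by gcongr
    nlinarith
  linarith

lemma ct_bad1 {V : Type*} [Fintype V] [Nonempty V] (M C : ℕ) (hC : 1 ≤ C)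
    (hn : 4 * C ≤ Fintype.card V) :
    𝔼 e : Fin M → V × V, ctInd (∃ S : Finset V, Fintype.card V ≤ 2 * C * S.card ∧
      ∀ j, ¬ ((e j).1 ∈ S ∧ (e j).2 ∈ S ∧ (e j).1 ≠ (e j).2)) ≤
      2 ^ (Fintype.card V) * (1 - 1 / (8 * (C:ℝ) ^ 2)) ^ M := by
  refine (Finset.expect_le_expect fun e _ => ctInd_exists_le _).trans ?_
  rw [Finset.expect_sum_comm]
  have hCr : (1:ℝ) ≤ C := by exact_mod_cast hC
  have hβ : 0 ≤ 1 - 1 / (8 * (C:ℝ) ^ 2) := by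
    rw [sub_nonneg, div_le_one (by positivity)]; nlinarith
  have h1 : ∀ S : Finset V, 𝔼 e : Fin M → V × V, ctInd (Fintype.card V ≤ 2 * C * S.card ∧
      ∀ j, ¬ ((e j).1 ∈ S ∧ (e j).2 ∈ S ∧ (e j).1 ≠ (e j).2)) ≤
      (1 - 1 / (8 * (C:ℝ) ^ 2)) ^ M := by
    intro S
    by_cases hS : Fintype.card V ≤ 2 * C * S.card
    · simp only [hS, true_and, ← ctInd_forall]
      rw [ct_expect_prod (fun (_ : Fin M) (p : V × V) => ctInd (¬ (p.1 ∈ S ∧ p.2 ∈ S ∧ p.1 ≠ p.2)))]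
      rw [Finset.prod_const, Finset.card_univ, Fintype.card_fin]
      exact pow_le_pow_left₀ (Finset.expect_nonneg fun _ _ => ctInd_nonneg _)
        (ct_edge_dens S C hC hn hS) M
    · simp only [hS, false_and]
      rw [ctInd_false (fun h => h), Finset.expect_const_zero]
      positivity
  refine (Finset.sum_le_sum fun S _ => h1 S).trans ?_
  simp

lemma ct_bad2 {V : Type*} [Fintype V] [Nonempty V] (M i : ℕ) (x : Fin i → V) (J : Fin i ↪ Fin M) :
    𝔼 e : Fin M → V × V, ctInd (∀ l, (e (J l)).1 ∈ Set.range x ∧ (e (J l)).2 ∈ Set.range x) ≤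
      ((i:ℝ) ^ 2 / (Fintype.card V : ℝ) ^ 2) ^ i := by
  have h1 := ct_marg (V := V × V) J J.injective
    (fun y => ctInd (∀ l, (y l).1 ∈ Set.range x ∧ (y l).2 ∈ Set.range x))
  simp only [Function.comp_apply] at h1
  rw [h1]
  simp only [← ctInd_forall]
  rw [ct_expect_prod (fun (_ : Fin i) (p : V × V) => ctInd (p.1 ∈ Set.range x ∧ p.2 ∈ Set.range x))]
  rw [Finset.prod_const, Finset.card_univ, Fintype.card_fin]
  refine pow_le_pow_left₀ (Finset.expect_nonneg fun _ _ => ctInd_nonneg _) ?_ i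
  have h2 := ctDens_card (fun p : V × V => p.1 ∈ Set.range x ∧ p.2 ∈ Set.range x)
  unfold ctDens at h2
  rw [h2]
  have h3 : (univ.filter (fun p : V × V => p.1 ∈ Set.range x ∧ p.2 ∈ Set.range x)).card ≤ i ^ 2 := by
    have : univ.filter (fun p : V × V => p.1 ∈ Set.range x ∧ p.2 ∈ Set.range x) =
      (univ.image x) ×ˢ (univ.image x) := by
      ext p; simp
    rw [this, Finset.card_product, sq]
    have : (univ.image x).card ≤ i := by simpa using Finset.card_image_le (s := univ) (f := x)
    exact Nat.mul_le_mul this this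
  rw [Fintype.card_prod, Nat.cast_mul, ← sq]
  have h3' : ((univ.filter (fun p : V × V => p.1 ∈ Set.range x ∧ p.2 ∈ Set.range x)).card : ℝ) ≤ (i:ℝ) ^ 2 := by
    exact_mod_cast h3
  gcongr

lemma ct_bad2_sum {V : Type*} [Fintype V] [Nonempty V] (A k : ℕ) :
    𝔼 e : Fin (A * Fintype.card V) → V × V,
      ∑ t : (Σ i : Fin k, (Fin (i+1) → V) × (Fin (i+1) ↪ Fin (A * Fintype.card V))),
        ctInd (∀ l, (e (t.2.2 l)).1 ∈ Set.range t.2.1 ∧ (e (t.2.2 l)).2 ∈ Set.range t.2.1) ≤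
      ∑ i : Fin k, ((A:ℝ) * ((i:ℝ) + 1) ^ 2) ^ ((i:ℕ)+1) := by
  rw [Finset.expect_sum_comm, Fintype.sum_sigma]
  refine Finset.sum_le_sum fun i _ => ?_
  refine (Finset.sum_le_sum fun t _ => ct_bad2 (A * Fintype.card V) (i+1) t.1 t.2).trans ?_
  rw [Finset.sum_const, nsmul_eq_mul, Finset.card_univ, Fintype.card_prod, Fintype.card_embedding_eq,
    Fintype.card_fun]
  simp only [Fintype.card_fin]
  have hV : (0:ℝ) < Fintype.card V := by exact_mod_cast Fintype.card_pos
  have h1 : ((A * Fintype.card V).descFactorial (i+1) : ℝ) ≤ ((A:ℝ) * Fintype.card V) ^ ((i:ℕ)+1) := by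
    exact_mod_cast Nat.descFactorial_le_pow _ _
  push_cast
  have h2 : (((i:ℝ) + 1) ^ 2 / (Fintype.card V:ℝ) ^ 2) ^ ((i:ℕ)+1) * ((Fintype.card V : ℝ) ^ ((i:ℕ)+1) *
      ((A:ℝ) * Fintype.card V) ^ ((i:ℕ)+1)) = ((A:ℝ) * ((i:ℝ) + 1) ^ 2) ^ ((i:ℕ)+1) := by
    rw [← mul_pow, ← mul_pow]
    congr 1
    field_simp
  rw [← h2, mul_comm]
  gcongr

lemma ct_sparse (k C : ℕ) : ∃ (m : ℕ) (Γ : SimpleGraph (Fin m)), 0 < m ∧ ¬ Γ.Colorable C ∧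
    ∀ S : Finset (Fin m), S.Nonempty → S.card ≤ k → ∃ v ∈ S, ctDeg Γ S v ≤ 1 := by
  suffices h : ∀ C : ℕ, 1 ≤ C → ∃ (m : ℕ) (Γ : SimpleGraph (Fin m)), 0 < m ∧ ¬ Γ.Colorable C ∧
    ∀ S : Finset (Fin m), S.Nonempty → S.card ≤ k → ∃ v ∈ S, ctDeg Γ S v ≤ 1 by
    obtain ⟨m, Γ, h0, h1, h2⟩ := h (C+1) (by omega)
    exact ⟨m, Γ, h0, fun hc => h1 (hc.mono (by omega)), h2⟩
  clear C
  intro C hC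
  have hCr : (1:ℝ) ≤ C := by exact_mod_cast hC
  set β : ℝ := 1 - 1 / (8 * (C:ℝ) ^ 2) with hβ
  have hβ0 : 0 ≤ β := by
    rw [hβ, sub_nonneg, div_le_one (by positivity)]; nlinarith
  have hβ1 : β < 1 := by
    have : 0 < 1 / (8 * (C:ℝ) ^ 2) := by positivity
    linarith
  obtain ⟨A, hA⟩ := exists_pow_lt_of_lt_one (by norm_num : (0:ℝ) < 1/4) hβ1
  set K : ℝ := ∑ i : Fin k, ((A:ℝ) * ((i:ℝ) + 1) ^ 2) ^ ((i:ℕ)+1) with hK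
  have hK0 : 0 ≤ K := Finset.sum_nonneg fun i _ => by positivity
  obtain ⟨n0, hn0⟩ := exists_nat_gt (4 * (K + 1))
  set n := n0 + 4 * C + 2 with hn
  have hnpos : 0 < n := by omega
  have : Nonempty (Fin n) := ⟨⟨0, hnpos⟩⟩
  have hcard : Fintype.card (Fin n) = n := Fintype.card_fin n
  set M := A * Fintype.card (Fin n) with hM
  have b1 := ct_bad1 (V := Fin n) M C hC (by rw [hcard]; omega)
  have b2 := ct_bad2_sum (V := Fin n) A k
  rw [← hM, ← hK] at b2
  rw [← hβ] at b1
  set bad1 : (Fin M → Fin n × Fin n) → Prop := fun e => (∃ S : Finset (Fin n),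
    Fintype.card (Fin n) ≤ 2 * C * S.card ∧
      ∀ j, ¬ ((e j).1 ∈ S ∧ (e j).2 ∈ S ∧ (e j).1 ≠ (e j).2)) with hbad1
  let bad2 : (Fin M → Fin n × Fin n) → (Σ i : Fin k, (Fin (i+1) → Fin n) × (Fin (i+1) ↪ Fin M)) → Prop :=
    fun e t => (∀ l, (e (t.2.2 l)).1 ∈ Set.range t.2.1 ∧ (e (t.2.2 l)).2 ∈ Set.range t.2.1)
  have b2' : 𝔼 e, ∑ t, ctInd (bad2 e t) ≤ K := b2
  have b1' : 𝔼 e, ctInd (bad1 e) ≤ 1 / 4 := by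
    refine b1.trans ?_
    rw [hM, hcard, pow_mul, ← mul_pow]
    have h1 : 2 * β ^ A ≤ 1 / 2 := by linarith
    have h2 : 0 ≤ 2 * β ^ A := by positivity
    calc (2 * β ^ A) ^ n ≤ (1/2) ^ n := pow_le_pow_left₀ h2 h1 n
      _ ≤ (1/2) ^ 2 := pow_le_pow_of_le_one (by norm_num) (by norm_num) (by omega)
      _ = 1 / 4 := by norm_num
  obtain ⟨e, he⟩ : ∃ e, ctInd (bad1 e) + (∑ t, ctInd (bad2 e t)) / (2 * (K + 1)) < 1 := by
    by_contra hcon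
    push Not at hcon
    have h1 : (1:ℝ) ≤ 𝔼 e, (ctInd (bad1 e) + (∑ t, ctInd (bad2 e t)) / (2 * (K + 1))) :=
      Finset.le_expect Finset.univ_nonempty fun e _ => hcon e
    rw [Finset.expect_add_distrib, ← Finset.expect_div] at h1
    have h2 : (𝔼 e, ∑ t, ctInd (bad2 e t)) / (2 * (K + 1)) ≤ 1 / 2 := by
      rw [div_le_div_iff₀ (by positivity) (by norm_num)]
      linarith
    linarith
  have hY0 : 0 ≤ ∑ t, ctInd (bad2 e t) := Finset.sum_nonneg fun _ _ => ctInd_nonneg _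
  have hnb : ¬ bad1 e := by
    intro hb
    rw [ctInd_true hb] at he
    have : 0 ≤ (∑ t, ctInd (bad2 e t)) / (2 * (K + 1)) := by positivity
    linarith
  have hY : ∑ t, ctInd (bad2 e t) < 2 * (K + 1) := by
    have h1 : (∑ t, ctInd (bad2 e t)) / (2 * (K + 1)) < 1 := by
      linarith [ctInd_nonneg (bad1 e)]
    rwa [div_lt_one (by positivity)] at h1
  set Z : Finset (Fin n) := (univ.filter (bad2 e)).image (fun t => t.2.1 0) with hZ
  have hZc : 2 * Z.card ≤ n := by
    have h1 : (Z.card : ℝ) ≤ ∑ t, ctInd (bad2 e t) := by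
      rw [ctInd_sum]
      exact_mod_cast Finset.card_image_le
    have h2 : (n0:ℝ) ≤ n := by exact_mod_cast (by omega : n0 ≤ n)
    have : (2 * Z.card : ℝ) ≤ n := by linarith
    exact_mod_cast this
  obtain ⟨Γ, hΓ⟩ : ∃ Γ : SimpleGraph (Fin n), ∀ u v, Γ.Adj u v ↔
      (u ≠ v ∧ u ∉ Z ∧ v ∉ Z ∧ ∃ j, e j = (u, v) ∨ e j = (v, u)) := ⟨
    { Adj := fun u v => u ≠ v ∧ u ∉ Z ∧ v ∉ Z ∧ ∃ j, e j = (u, v) ∨ e j = (v, u)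
      symm := ⟨fun u v ⟨h1, h2, h3, j, h4⟩ => ⟨h1.symm, h3, h2, j, h4.symm⟩⟩
      loopless := ⟨fun u h => h.1 rfl⟩ }, fun _ _ => Iff.rfl⟩
  refine ⟨n, Γ, hnpos, ?_, ?_⟩
  · rintro ⟨col⟩
    apply hnb
    have h1 : (univ \ Z).card * 2 ≥ n := by
      have := Finset.card_sdiff_add_card_inter (univ : Finset (Fin n)) Z
      simp only [Finset.univ_inter, Finset.card_univ, Fintype.card_fin] at this
      omega
    have h2 : ∃ c : Fin C, n ≤ 2 * C * ((univ \ Z).filter (fun v => col v = c)).card := by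
      by_contra hcon
      push Not at hcon
      have h3 := Finset.card_eq_sum_card_fiberwise (s := univ \ Z) (t := (univ : Finset (Fin C)))
        (f := col) (fun _ _ => by simp)
      have h4 : ∑ c : Fin C, 2 * C * ((univ \ Z).filter (fun v => col v = c)).card < ∑ c : Fin C, n :=
        Finset.sum_lt_sum_of_nonempty ⟨⟨0, by omega⟩, by simp⟩ fun c _ => hcon c
      rw [← Finset.mul_sum, ← h3] at h4
      simp only [Finset.sum_const, Finset.card_univ, Fintype.card_fin, smul_eq_mul] at h4
      nlinarith
    obtain ⟨c, hc⟩ := h2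
    refine ⟨(univ \ Z).filter (fun v => col v = c), by rw [hcard]; exact hc, ?_⟩
    rintro j ⟨hu, hv, hne⟩
    simp only [Finset.mem_filter, Finset.mem_sdiff, Finset.mem_univ, true_and] at hu hv
    exact col.valid (v := (e j).1) (w := (e j).2)
      ((hΓ _ _).2 ⟨hne, hu.1, hv.1, j, Or.inl rfl⟩) (hu.2.trans hv.2.symm)
  · intro S hSne hSk
    by_contra hcon
    push Not at hcon
    set Js := univ.filter (fun j => (e j).1 ∈ S ∧ (e j).2 ∈ S) with hJs
    have h1 : S.card * 2 ≤ ((S ×ˢ S).filter (fun z => Γ.Adj z.1 z.2)).card := by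
      rw [ct_pairs_card]
      calc S.card * 2 = ∑ v ∈ S, 2 := by rw [Finset.sum_const, smul_eq_mul]
        _ ≤ _ := Finset.sum_le_sum fun v hv => hcon v hv
    have h2 : (S ×ˢ S).filter (fun z => Γ.Adj z.1 z.2) ⊆ Js.image e ∪ Js.image (fun j => (e j).swap) := by
      rintro ⟨u, v⟩ hz
      simp only [Finset.mem_filter, Finset.mem_product, hΓ] at hz
      obtain ⟨⟨hu, hv⟩, -, -, -, j, hj | hj⟩ := hz
      · refine Finset.mem_union_left _ (Finset.mem_image.2 ⟨j, ?_, hj⟩)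
        simp [hJs, hj, hu, hv]
      · refine Finset.mem_union_right _ (Finset.mem_image.2 ⟨j, ?_, by rw [hj]; rfl⟩)
        simp [hJs, hj, hu, hv]
    have h3 : S.card ≤ Js.card := by
      have := (Finset.card_le_card h2).trans (Finset.card_union_le _ _)
      have q1 := Finset.card_image_le (s := Js) (f := e)
      have q2 := Finset.card_image_le (s := Js) (f := fun j => (e j).swap)
      omega
    have hSpos : 0 < S.card := hSne.card_pos
    obtain ⟨i, hi⟩ : ∃ i, S.card = i + 1 := ⟨S.card - 1, by omega⟩
    obtain ⟨J, hJ⟩ := ct_emb_of_card Js (i+1) (by omega)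
    obtain ⟨x, hx⟩ := ct_emb_of_card S (i+1) (by omega)
    have hrange : ∀ v ∈ S, v ∈ Set.range x := by
      have : univ.image x = S := by
        apply Finset.eq_of_subset_of_card_le
        · intro v hv
          obtain ⟨l, -, rfl⟩ := Finset.mem_image.1 hv
          exact hx l
        · rw [Finset.card_image_of_injective _ x.injective, Finset.card_univ, Fintype.card_fin, hi]
      intro v hv
      rw [← this] at hv
      obtain ⟨l, -, rfl⟩ := Finset.mem_image.1 hv
      exact ⟨l, rfl⟩
    have hx0 : x 0 ∈ Z := by
      refine Finset.mem_image.2 ⟨⟨⟨i, by omega⟩, (x, J)⟩, ?_, rfl⟩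
      simp only [Finset.mem_filter, Finset.mem_univ, true_and]
      intro l
      have := hJ l
      simp only [hJs, Finset.mem_filter, Finset.mem_univ, true_and] at this
      exact ⟨hrange _ this.1, hrange _ this.2⟩
    have h4 := hcon (x 0) (hx 0)
    have h5 : ctDeg Γ S (x 0) = 0 := by
      unfold ctDeg
      rw [Finset.card_eq_zero, Finset.filter_eq_empty_iff]
      intro w _ hw
      exact ((hΓ _ _).1 hw).2.1 hx0
    omega

end CTsparse

section CTnear
open Finset
open scoped BigOperators Classical

lemma ct_near {α : Type*} [Fintype α] (H : SimpleGraph α) (S : ℕ) (hS : 1 ≤ S)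
    (h0 : 0 < chromThreshold H) (h1 : chromThreshold H < S / (S + 1)) :
    ∃ c : α → Fin (S+1), (∀ a b, H.Adj a b → c a = c b → c a = 0) ∧
      ∀ B : Finset α, B.Nonempty → (∀ a ∈ B, c a = 0) → ∃ a ∈ B, ctDeg H B a ≤ 1 := by
  unfold chromThreshold at h0 h1
  have hne : {d : ℝ | 0 < d ∧ ∃ C : ℕ, ∀ (n : ℕ) (G : SimpleGraph (Fin n)),
    ¬ ContainsCopy H G → (∀ v, d * n ≤ ((G.neighborSet v).ncard : ℝ)) →
    G.chromaticNumber ≤ (C : ℕ∞) }.Nonempty := by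
    by_contra h
    rw [Set.not_nonempty_iff_eq_empty] at h
    rw [h, Real.sInf_empty] at h0
    exact lt_irrefl _ h0
  obtain ⟨d, ⟨hd0, C, hC⟩, hd⟩ := exists_lt_of_csInf_lt hne h1
  obtain ⟨m, Γ, hm, hcol, hsp⟩ := ct_sparse (Fintype.card α) C
  let q : Fin ((S+1) * m) ≃ Fin (S+1) × Fin m := finProdFinEquiv.symm
  obtain ⟨G, hG⟩ : ∃ G : SimpleGraph (Fin ((S+1) * m)), ∀ x y, G.Adj x y ↔
      ((q x).1 ≠ (q y).1 ∨ ((q x).1 = (q y).1 ∧ (q x).1 = 0 ∧ Γ.Adj (q x).2 (q y).2)) := ⟨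
    { Adj := fun x y => ((q x).1 ≠ (q y).1 ∨ ((q x).1 = (q y).1 ∧ (q x).1 = 0 ∧ Γ.Adj (q x).2 (q y).2))
      symm := ⟨fun x y h => by
        rcases h with h | ⟨h1, h2, h3⟩
        · exact Or.inl h.symm
        · exact Or.inr ⟨h1.symm, h1 ▸ h2, h3.symm⟩⟩
      loopless := ⟨fun x h => by
        rcases h with h | ⟨h1, h2, h3⟩
        · exact h rfl
        · exact Γ.loopless.irrefl _ h3⟩ }, fun _ _ => Iff.rfl⟩
  have hcont : ContainsCopy H G := by
    by_contra hfree
    have hchi := hC _ G hfree (by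
      intro v
      have hsub : ((((univ.erase (q v).1) ×ˢ (univ : Finset (Fin m))).map q.symm.toEmbedding :
          Finset (Fin ((S+1) * m))) : Set (Fin ((S+1) * m))) ⊆ G.neighborSet v := by
        intro y hy
        rw [Finset.mem_coe, Finset.mem_map] at hy
        obtain ⟨z, hz, rfl⟩ := hy
        simp only [Finset.mem_product, Finset.mem_erase, Finset.mem_univ, and_true] at hz
        rw [SimpleGraph.mem_neighborSet, hG]
        left
        simpa using hz.symm
      have h2 := Set.ncard_le_ncard hsub (Set.toFinite _)
      rw [Set.ncard_coe_finset, Finset.card_map, Finset.card_product,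
        Finset.card_erase_of_mem (Finset.mem_univ _)] at h2
      simp only [Finset.card_univ, Fintype.card_fin, Nat.add_sub_cancel] at h2
      have h3 : ((S * m : ℕ) : ℝ) ≤ (G.neighborSet v).ncard := by exact_mod_cast h2
      refine le_trans ?_ h3
      push_cast
      have h4 : d * ((S + 1) * m) ≤ S / (S + 1) * ((S + 1) * m) :=
        mul_le_mul_of_nonneg_right hd.le (by positivity)
      have h5 : (S:ℝ) / (S + 1) * ((S + 1) * m) = S * m := by field_simp
      linarith)
    rw [SimpleGraph.chromaticNumber_le_iff_colorable] at hchi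
    apply hcol
    obtain ⟨col⟩ := hchi
    refine ⟨SimpleGraph.Coloring.mk (fun a => col (q.symm (0, a))) ?_⟩
    intro a b hab
    refine col.valid ?_
    rw [hG]
    right
    simpa using hab
  obtain ⟨f, hf, hfa⟩ := hcont
  refine ⟨fun a => (q (f a)).1, ?_, ?_⟩
  · intro a b hab hc
    rcases (hG _ _).1 (hfa hab) with h | ⟨-, h, -⟩
    · exact absurd hc h
    · exact h
  · intro B hB hB0
    have hinj : Set.InjOn (fun a => (q (f a)).2) B := by
      intro a ha b hb hab
      apply hf
      apply q.injective
      exact Prod.ext ((hB0 a ha).trans (hB0 b hb).symm) hab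
    obtain ⟨v, hv, hdeg⟩ := hsp (B.image (fun a => (q (f a)).2)) (hB.image _)
      (Finset.card_image_le.trans (Finset.card_le_univ _))
    obtain ⟨a, ha, rfl⟩ := Finset.mem_image.1 hv
    refine ⟨a, ha, le_trans ?_ hdeg⟩
    unfold ctDeg
    refine Finset.card_le_card_of_injOn (fun a => (q (f a)).2) ?_ ?_
    · intro b hb
      rw [Finset.mem_coe, Finset.mem_filter] at hb
      rw [Finset.mem_coe, Finset.mem_filter]
      refine ⟨Finset.mem_image_of_mem _ hb.1, ?_⟩
      rcases (hG _ _).1 (hfa hb.2) with h | ⟨-, -, h⟩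
      · exact absurd ((hB0 a ha).trans (hB0 b hb.1).symm) h
      · exact h
    · intro b hb b' hb'
      exact hinj (Finset.mem_filter.1 hb).1 (Finset.mem_filter.1 hb').1

end CTnear

section CTmain
open Finset
open scoped BigOperators Classical

lemma ct_deg_dens {n : ℕ} (hn : 0 < n) (G : SimpleGraph (Fin n)) (v : Fin n) :
    𝔼 w, ctInd (G.Adj v w) = ((G.neighborSet v).ncard : ℝ) / n := by
  have h := ctDens_card (fun w => G.Adj v w)
  unfold ctDens at h
  rw [h, Fintype.card_fin]
  congr 2
  rw [← Set.ncard_coe_finset]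
  congr 1
  ext w
  simp

lemma ct_edge_expect {n : ℕ} (hn : 0 < n) (G : SimpleGraph (Fin n)) :
    𝔼 u, 𝔼 v, ctInd (G.Adj u v) = 2 * (G.edgeSet.ncard : ℝ) / n ^ 2 := by
  simp only [ct_deg_dens hn]
  rw [Fintype.expect_eq_sum_div_card, ← Finset.sum_div, Fintype.card_fin, div_div, ← sq]
  congr 1
  have h1 := G.sum_degrees_eq_twice_card_edges
  have h2 : ∀ v, (G.neighborSet v).ncard = G.degree v := by
    intro v
    have h := Set.ncard_coe_finset (G.neighborFinset v)
    rw [SimpleGraph.coe_neighborFinset] at h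
    rw [h, SimpleGraph.card_neighborFinset_eq_degree]
  have h3 : G.edgeSet.ncard = G.edgeFinset.card := by
    have h := Set.ncard_coe_finset G.edgeFinset
    rw [SimpleGraph.coe_edgeFinset] at h
    exact h
  simp only [h2, h3]
  exact_mod_cast h1

lemma ct_main {α : Type*} [Fintype α] [Nonempty α] (H : SimpleGraph α) (S : ℕ) (hS : 1 ≤ S)
    (c0 : α → Fin (S+1+1)) (hc0 : ∀ a b, H.Adj a b → c0 a ≠ c0 b)
    (c' : α → Fin (S+1)) (hc' : ∀ a b, H.Adj a b → c' a = c' b → c' a = 0)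
    (hforest : ∀ B : Finset α, B.Nonempty → (∀ a ∈ B, c' a = 0) → ∃ a ∈ B, ctDeg H B a ≤ 1)
    (c μ δ ε : ℝ) (hε : 0 < ε)
    (hc : 0 ≤ c) (hμ : 0 ≤ μ) (h1 : (S + 1) * c + μ * (S - 1 / 2) = 1)
    (h2 : c * (S - 1 / 2) + μ * (S - 3 / 4) = δ) :
    ∃ (C : ℕ) (n₀ : ℕ), ∀ n : ℕ, n₀ ≤ n → ∀ G : SimpleGraph (Fin n),
      ¬ ContainsCopy H G →
      (∀ v, δ * n ≤ ((G.neighborSet v).ncard : ℝ)) →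
      (1 / 2 - c / 2 - μ * δ / 2 + ε) * n ^ 2 < (G.edgeSet.ncard : ℝ) →
      G.chromaticNumber ≤ (C : ℕ∞) := by
  obtain ⟨c1, hc1, htri⟩ := ct_tri S hS c μ δ ε hε hc hμ h1 h2
  set a : ℝ := (Fintype.card α : ℝ) with ha
  have ha0 : 0 < a := by rw [ha]; exact_mod_cast Fintype.card_pos
  set p2 : ℝ := c1 / 2 ^ (S+3) with hp2
  have hp20 : 0 < p2 := by positivity
  set η : ℝ := c1 / ((S+1) * 2 ^ (S+2)) with hη
  have hη0 : 0 < η := by positivity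
  obtain ⟨N, hN⟩ := ct_cover (η ^ 2) (by positivity)
  set q2 : ℝ := p2 ^ (Fintype.card α ^ (S+1)) / 2 with hq2
  have hq20 : 0 < q2 := by positivity
  set q3 : ℝ := c1 ^ (Fintype.card α ^ S) / 2 with hq3
  have hq30 : 0 < q3 := by positivity
  obtain ⟨N2, hN2⟩ := exists_nat_gt (a / q2)
  obtain ⟨D, hD⟩ := exists_nat_gt (2 * a / q3)
  obtain ⟨n0, hn0⟩ := exists_nat_gt (1 + ((S+1) * a ^ 2) / q2 + (S * a ^ 2) / q3 + 2 * a / (q2 * c1))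
  refine ⟨N2 + N * (D+1), n0, ?_⟩
  intro n hn G hfree hdeg hedge
  have t1 : 0 ≤ ((S+1) * a ^ 2) / q2 := by positivity
  have t2 : 0 ≤ (S * a ^ 2) / q3 := by positivity
  have t3 : 0 ≤ 2 * a / (q2 * c1) := by positivity
  have hnn : (n0:ℝ) ≤ n := by exact_mod_cast hn
  have hnr : (0:ℝ) < n := by linarith
  have hnpos : 0 < n := by exact_mod_cast hnr
  have : Nonempty (Fin n) := ⟨⟨0, hnpos⟩⟩
  have k1 : (S+1) * a ^ 2 ≤ q2 * n := by
    have : ((S+1) * a ^ 2) / q2 ≤ n := by linarith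
    rw [div_le_iff₀ hq20] at this; linarith
  have k2 : S * a ^ 2 ≤ q3 * n := by
    have : (S * a ^ 2) / q3 ≤ n := by linarith
    rw [div_le_iff₀ hq30] at this; linarith
  have k3 : 2 * a < q2 * c1 * n := by
    have : 2 * a / (q2 * c1) < n := by linarith
    rw [div_lt_iff₀ (by positivity)] at this; linarith
  set B2 : Finset (Fin n) := univ.filter (fun u => p2 ≤ ctDens (fun x : Fin (S+1) → Fin n =>
    ctClq G x ∧ ∀ i, G.Adj u (x i))) with hB2
  have hB2m : ∀ u, u ∈ B2 ↔ p2 ≤ ctDens (fun x : Fin (S+1) → Fin n =>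
    ctClq G x ∧ ∀ i, G.Adj u (x i)) := fun u => by simp [hB2]
  have hB2c : q2 * B2.card < a := by
    refine ct_many_nbr H G (S+1) hfree c0 hc0 B2 p2 hp20 (fun u hu => (hB2m u).1 hu) ?_
    rw [Fintype.card_fin]
    push_cast
    exact k1
  have hB2N : B2.card ≤ N2 := by
    have : (B2.card : ℝ) ≤ N2 := by
      have h3 : (B2.card : ℝ) < a / q2 := by rw [lt_div_iff₀ hq20]; linarith
      linarith
    exact_mod_cast this
  have hpow : (2:ℝ) ^ (S+1) * p2 = c1 / 4 := by
    rw [hp2, pow_add _ S 3, pow_add _ S 1]; field_simp; norm_num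
  have hp2le : p2 ≤ c1 / 4 := by
    rw [← hpow]
    exact le_mul_of_one_le_left hp20.le (one_le_pow₀ (by norm_num))
  -- few copies of the complete graph on `S+2` vertices
  have hnoK : ¬ c1 ≤ ctDens (fun x : Fin (S+2) → Fin n => ctClq G x) := by
    intro hK
    have e1 : ctDens (fun x : Fin (S+2) → Fin n => ctClq G x) ≤ 𝔼 u, (ctInd (u ∈ B2) + p2) := by
      unfold ctDens
      rw [ct_insertNth (0 : Fin (S+1+1))]
      refine Finset.expect_le_expect fun u _ => ?_
      have e2 : 𝔼 y : Fin (S+1) → Fin n, ctInd (ctClq G (Fin.insertNth 0 u y : Fin (S+1+1) → Fin n)) =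
          ctDens (fun x : Fin (S+1) → Fin n => ctClq G x ∧ ∀ i, G.Adj u (x i)) := by
        unfold ctDens
        refine Finset.expect_congr rfl fun y _ => ctInd_congr ?_
        rw [ctClq_insertNth]
        simp only [G.adj_comm u]
      rw [e2]
      by_cases hu : u ∈ B2
      · rw [ctInd_true hu]
        have : ctDens (fun x : Fin (S+1) → Fin n => ctClq G x ∧ ∀ i, G.Adj u (x i)) ≤ 1 :=
          Finset.expect_le Finset.univ_nonempty fun _ _ => ctInd_le_one _
        linarith
      · rw [ctInd_false hu, zero_add]
        rw [hB2m] at hu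
        exact (not_le.1 hu).le
    have e3 : 𝔼 u, ctInd (u ∈ B2) = B2.card / n := by
      have := ctDens_card (fun u => u ∈ B2)
      unfold ctDens at this
      rw [this, Fintype.card_fin]
      simp
    rw [Finset.expect_add_distrib, Fintype.expect_const, e3] at e1
    have e4 : c1 / 2 ≤ B2.card / n := by linarith
    rw [le_div_iff₀ hnr] at e4
    have e5 := mul_le_mul_of_nonneg_left e4 hq20.le
    nlinarith
  obtain ⟨col, hcol⟩ := hN (Fin n) (Fin S → Fin n) (Fin n)
    (fun y v => ctInd (∀ i, G.Adj (y i) v)) (fun u v => ctInd (G.Adj u v))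
    (fun _ _ => ctInd_abs _) (fun _ _ => ctInd_abs _)
  have hE : 2 * (1 / 2 - c / 2 - μ * δ / 2 + ε) ≤ 𝔼 u, 𝔼 v, ctInd (G.Adj u v) := by
    rw [ct_edge_expect hnpos, le_div_iff₀ (by positivity)]
    linarith
  have hpair : ∀ u v, u ∉ B2 → col u = col v →
      c1 ≤ ctDens (fun x : Fin S → Fin n => ctClq G x ∧ ∀ i, (G.Adj u (x i) ∧ G.Adj v (x i))) := by
    intro u v hu huv
    rcases htri (Fin n) G (fun w => G.Adj u w) (fun w => G.Adj v w) (by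
      rw [Finset.expect_add_distrib, ct_deg_dens hnpos, ct_deg_dens hnpos]
      have d1 := hdeg u
      have d2 := hdeg v
      rw [← le_div_iff₀ hnr] at d1 d2
      linarith) hE with h | h | h
    · exact absurd h hnoK
    · exfalso
      have g1 := ct_union_dens G S u v (η ^ 2) (hcol u v huv)
      rw [Real.sqrt_sq hη0.le] at g1
      rw [hB2m] at hu
      have g2 : (2:ℝ) ^ (S+1) * ctDens (fun x : Fin (S+1) → Fin n => ctClq G x ∧ ∀ i, G.Adj u (x i)) ≤
          2 ^ (S+1) * p2 := mul_le_mul_of_nonneg_left (not_le.1 hu).le (by positivity)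
      have g3 : ((S:ℝ)+1) * (2 ^ S * η) = c1 / 4 := by
        rw [hη, pow_add _ S 2]; field_simp; norm_num
      linarith
    · exact h
  have hdegen : ∀ k : Fin N, ∃ cc : Fin n → Fin (D+1),
      ∀ u ∈ univ.filter (fun u => u ∉ B2 ∧ col u = k),
      ∀ v ∈ univ.filter (fun u => u ∉ B2 ∧ col u = k), G.Adj u v → cc u ≠ cc v := by
    intro k
    refine ct_degen_color G D _ ?_
    intro T hT hTne
    by_contra hcon
    push Not at hcon
    refine hfree (ct_forest_copy H G S c' hc' hforest T hTne c1 hc1 D ?_ hcon ?_ ?_)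
    · rw [div_lt_iff₀ hq30] at hD
      have hh : 2 * a ≤ q3 * D := by linarith
      exact hh
    · intro u hu v hv _
      have m1 := (Finset.mem_filter.1 (hT hu)).2
      have m2 := (Finset.mem_filter.1 (hT hv)).2
      exact hpair u v m1.1 (m1.2.trans m2.2.symm)
    · rw [Fintype.card_fin]
      exact k2
  choose cc hcc using hdegen
  have hcolor : G.Colorable (Fintype.card ({u // u ∈ B2} ⊕ (Fin N × Fin (D+1)))) := by
    refine SimpleGraph.Coloring.colorable (SimpleGraph.Coloring.mk
      (fun u => if h : u ∈ B2 then Sum.inl ⟨u, h⟩ else Sum.inr (col u, cc (col u) u)) ?_)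
    intro u v huv heq
    by_cases hu : u ∈ B2 <;> by_cases hv : v ∈ B2 <;> simp [hu, hv] at heq
    · exact huv.ne heq
    · obtain ⟨heq1, heq2⟩ := heq
      rw [← heq1] at heq2
      exact hcc (col u) u (by simp [hu]) v (by simp [hv, heq1]) huv heq2
  rw [SimpleGraph.chromaticNumber_le_iff_colorable]
  refine hcolor.mono ?_
  rw [Fintype.card_sum, Fintype.card_coe, Fintype.card_prod, Fintype.card_fin, Fintype.card_fin]
  omega

lemma ct_alg (s δ : ℝ) (hq : 0 < 5 * s - 4) :
    (s + 1) * ((4 * s - 3 - δ * (4 * s - 2)) / (5 * s - 4))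
      + (4 * ((s + 1) * δ - (s - 1 / 2)) / (5 * s - 4)) * (s - 1 / 2) = 1 ∧
    ((4 * s - 3 - δ * (4 * s - 2)) / (5 * s - 4)) * (s - 1 / 2)
      + (4 * ((s + 1) * δ - (s - 1 / 2)) / (5 * s - 4)) * (s - 3 / 4) = δ ∧
    1 / 2 - (4 * s - 3 - δ * (4 * s - 2)) / (5 * s - 4) / 2
      - (4 * ((s + 1) * δ - (s - 1 / 2)) / (5 * s - 4)) * δ / 2 =
    (-4 * (s + 2 - 1) * δ ^ 2 + 4 * (2 * (s + 2) - 5) * δ + (s + 2) - 3) / (10 * (s + 2) - 28) := by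
  obtain ⟨q, hs⟩ : ∃ q, q = 5 * s - 4 := ⟨_, rfl⟩
  have e : s = (q + 4) / 5 := by linarith
  have h2 : 10 * (s + 2) - 28 = 2 * q := by linarith
  rw [h2, ← hs]
  rw [← hs] at hq
  subst e
  have hq0 : q ≠ 0 := hq.ne'
  refine ⟨?_, ?_, ?_⟩ <;> · field_simp; ring

end CTmain

theorem stmt_1 {α : Type*} [Fintype α] (H : SimpleGraph α) (r : ℕ) (hr : 3 ≤ r)
    (hchi : H.chromaticNumber = (r : ℕ∞))
    (hthr : chromThreshold H = (2 * (r : ℝ) - 5) / (2 * (r : ℝ) - 3))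
    (δ : ℝ) (hδl : (2 * (r : ℝ) - 5) / (2 * (r : ℝ) - 2) ≤ δ)
    (hδu : δ ≤ (5 * (r : ℝ) - 13) / (5 * (r : ℝ) - 8))
    (ε : ℝ) (hε : 0 < ε) :
    ∃ (C : ℕ) (n₀ : ℕ), ∀ n : ℕ, n₀ ≤ n → ∀ G : SimpleGraph (Fin n),
      ¬ ContainsCopy H G →
      (∀ v, δ * n ≤ ((G.neighborSet v).ncard : ℝ)) →
      ((-4 * ((r : ℝ) - 1) * δ ^ 2 + 4 * (2 * (r : ℝ) - 5) * δ + (r : ℝ) - 3)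
          / (10 * (r : ℝ) - 28) + ε) * n ^ 2 < (G.edgeSet.ncard : ℝ) →
      G.chromaticNumber ≤ (C : ℕ∞) := by
  obtain ⟨S, rfl⟩ : ∃ S, r = S + 2 := ⟨r - 2, by omega⟩
  have hS : 1 ≤ S := by omega
  have hSr : (1:ℝ) ≤ S := by exact_mod_cast hS
  push_cast at hthr hδl hδu ⊢
  have hcolH : H.Colorable (S + 2) := by
    rw [← SimpleGraph.chromaticNumber_le_iff_colorable, hchi]
  have hne : Nonempty α := by
    by_contra h
    rw [not_nonempty_iff] at h
    have h0 : H.Colorable 0 := SimpleGraph.Colorable.of_isEmpty 0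
    have := SimpleGraph.chromaticNumber_le_iff_colorable.2 h0
    rw [hchi] at this
    have : S + 2 ≤ 0 := by exact_mod_cast this
    omega
  obtain ⟨c0⟩ := hcolH
  have hth : chromThreshold H = (2 * S - 1) / (2 * S + 1) := by
    rw [hthr]; congr 1 <;> ring
  obtain ⟨c', hc', hforest⟩ := ct_near H S hS
    (by rw [hth]; exact div_pos (by linarith) (by linarith))
    (by rw [hth, div_lt_div_iff₀ (by linarith) (by linarith)]; nlinarith)
  have hq : (0:ℝ) < 5 * S - 4 := by linarith
  rw [div_le_iff₀ (by linarith)] at hδl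
  rw [le_div_iff₀ (by linarith)] at hδu
  obtain ⟨C, n₀, h⟩ := ct_main H S hS (fun a => c0 a) (fun a b hab => c0.valid hab) c' hc' hforest
    ((4 * S - 3 - δ * (4 * S - 2)) / (5 * S - 4)) (4 * ((S + 1) * δ - (S - 1 / 2)) / (5 * S - 4))
    δ ε hε
    (div_nonneg (by
      have h1 : δ * (5 * S + 2) ≤ 5 * S - 3 := by linarith
      have h2 : (δ * (5 * S + 2)) * (4 * S - 2) ≤ (5 * S - 3) * (4 * S - 2) :=
        mul_le_mul_of_nonneg_right h1 (by linarith)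
      have h3 : (δ * (4 * S - 2)) * (5 * S + 2) ≤ (4 * S - 3) * (5 * S + 2) := by nlinarith
      have := le_of_mul_le_mul_right h3 (by linarith)
      linarith) hq.le)
    (div_nonneg (by linarith) hq.le)
    (ct_alg S δ hq).1 (ct_alg S δ hq).2.1
  refine ⟨C, n₀, fun n hn G hfree hdeg hedge => h n hn G hfree hdeg ?_⟩
  convert hedge using 3
  exact (ct_alg S δ hq).2.2
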